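/- arXiv:2410.12131 — 4 statements merged into one kernel-verified Lean document; each statement's English description precedes it below -/
import Mathlib

section
/- Let γ : ℝ/ℤ → ℝ² be a Lipschitz closed curve with constant unit speed such that ω(γ, x) ∈ {0, 1} for all x ∉ γ(ℝ/ℤ). Suppose x ∈ γ(ℝ/ℤ) has exactly two preimages t₁ ≠ t₂ and γ is differentiable at t₁ and t₂ with nonzero derivatives. Then γ'(t₁) = −γ'(t₂). -/
open MeasureTheory Set

/-- Winding number of a closed curve (1-periodic map ℝ → ℂ) around a point. -/
noncomputable def winding (γ : ℝ → ℂ) (x : ℂ) : ℂ :=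
  (2 * Real.pi * Complex.I)⁻¹ * ∫ t in (0:ℝ)..1, deriv γ t / (γ t - x)

open Filter Topology

/-- The fundamental theorem of calculus for locally Lipschitz complex-valued functions. -/
theorem integral_eq_sub_of_locallyLipschitzOn {F F' : ℝ → ℂ} {a b : ℝ}
    (hF : LocallyLipschitzOn (uIcc a b) F)
    (hd : ∀ᵐ t, t ∈ uIcc a b → HasDerivAt F (F' t) t)
    (hint : IntervalIntegrable F' volume a b) :
    ∫ t in a..b, F' t = F b - F a := by
  obtain ⟨C, hC⟩ := hF.exists_lipschitzOnWith_of_compact isCompact_uIcc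
  have key (L : ℂ →L[ℝ] ℝ) : L (∫ t in a..b, F' t) = L (F b - F a) := by
    rw [map_sub, ← L.intervalIntegral_comp_comm hint]
    refine Eq.trans (intervalIntegral.integral_congr_ae ?_)
      (L.lipschitz.comp_lipschitzOnWith hC).absolutelyContinuousOnInterval.integral_deriv_eq_sub
    filter_upwards [hd] with t ht hmem
    exact (L.hasFDerivAt.comp_hasDerivAt t (ht (uIoc_subset_uIcc hmem))).deriv.symm
  exact Complex.ext (key Complex.reCLM) (key Complex.imCLM)

theorem LipschitzWith.intervalIntegrable_deriv {f : ℝ → ℂ} {K : NNReal}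
    (hf : LipschitzWith K f) (a b : ℝ) : IntervalIntegrable (deriv f) volume a b := by
  refine (intervalIntegrable_const (c := (K : ℝ))).mono_fun
    (measurable_deriv f).aestronglyMeasurable (ae_of_all _ fun t => ?_)
  simpa using norm_deriv_le_of_lipschitz hf

theorem LipschitzWith.intervalIntegrable_deriv_div {f h : ℝ → ℂ} {K : NNReal}
    (hf : LipschitzWith K f) {a b : ℝ} (hh : Continuous h) (h0 : ∀ t ∈ uIcc a b, h t ≠ 0) :
    IntervalIntegrable (fun t => deriv f t / h t) volume a b := by
  simp only [div_eq_mul_inv]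
  exact (hf.intervalIntegrable_deriv a b).mul_continuousOn (hh.continuousOn.inv₀ h0)

theorem integral_deriv_div_eq_log_sub {f : ℝ → ℂ} {K : NNReal} (hf : LipschitzWith K f)
    {a b : ℝ} (hs : ∀ t ∈ uIcc a b, f t ∈ Complex.slitPlane) :
    ∫ t in a..b, deriv f t / f t = Complex.log (f b) - Complex.log (f a) := by
  refine integral_eq_sub_of_locallyLipschitzOn (F := fun t => Complex.log (f t)) ?_ ?_
    (hf.intervalIntegrable_deriv_div hf.continuous
      fun t ht => Complex.slitPlane_ne_zero (hs t ht))
  · intro t ht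
    obtain ⟨C, u, hu, hC⟩ :=
      (Complex.contDiffAt_log (n := 1) (hs t ht)).exists_lipschitzOnWith
    refine ⟨C * K, f ⁻¹' u, mem_nhdsWithin_of_mem_nhds (hf.continuous.continuousAt hu), ?_⟩
    exact hC.comp (hf.lipschitzOnWith) (mapsTo_preimage f u)
  · filter_upwards [hf.ae_differentiableAt_real] with t ht hmem
    exact ht.hasDerivAt.clog_real (hs t hmem)

theorem Complex.log_neg_sub_log_of_im_neg {z : ℂ} (hz : z.im < 0) :
    log (-z) - log z = Real.pi * I := by
  simp only [log, norm_neg, arg_neg_eq_arg_add_pi_of_im_neg hz]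
  push_cast
  ring

theorem Complex.log_neg_sub_log_of_im_pos {z : ℂ} (hz : 0 < z.im) :
    log (-z) - log z = -(Real.pi * I) := by
  simp only [log, norm_neg, arg_neg_eq_arg_sub_pi_of_im_pos hz]
  push_cast
  ring

/-- The difference between the integrands of the winding integrals around `ε` and `-ε`. -/
noncomputable def windingJump (g : ℝ → ℂ) (ε t : ℝ) : ℂ :=
  deriv g t / (g t - ε) - deriv g t / (g t + ε)

theorem intervalIntegrable_windingJump {g : ℝ → ℂ} {K : NNReal} (hg : LipschitzWith K g)
    {ε a b : ℝ} (h : ∀ t ∈ uIcc a b, g t ≠ ε ∧ g t ≠ -ε) :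
    IntervalIntegrable (windingJump g ε) volume a b := by
  have hc := hg.continuous
  refine (hg.intervalIntegrable_deriv_div (by fun_prop) fun t ht => ?_).sub
    (hg.intervalIntegrable_deriv_div (by fun_prop) fun t ht => ?_)
  · exact sub_ne_zero.2 (h t ht).1
  · rw [← sub_neg_eq_add]
    exact sub_ne_zero.2 (h t ht).2

theorem exists_pos_le_norm_of_ne_zero {g : ℝ → ℂ} (hg : Continuous g) {a b : ℝ}
    (h0 : ∀ t ∈ uIcc a b, g t ≠ 0) : ∃ m > 0, ∀ t ∈ uIcc a b, m ≤ ‖g t‖ := by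
  obtain ⟨t, ht, hmin⟩ := isCompact_uIcc.exists_isMinOn nonempty_uIcc
    (hg.norm.continuousOn (s := uIcc a b))
  exact ⟨‖g t‖, norm_pos_iff.2 (h0 t ht), fun u hu => hmin hu⟩

theorem half_le_norm_sub_and_add {z : ℂ} {m ε : ℝ} (hε : 0 < ε) (hεm : ε < m / 2)
    (hz : m ≤ ‖z‖) : m / 2 ≤ ‖z - ε‖ ∧ m / 2 ≤ ‖z + ε‖ := by
  have hn : ‖(ε : ℂ)‖ = ε := by simp [abs_of_pos hε]
  have h₁ := norm_sub_norm_le z ε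
  have h₂ := norm_sub_le (z + ε) ε
  rw [add_sub_cancel_right] at h₂
  constructor <;> linarith

theorem eventually_ne_of_ne_zero {g : ℝ → ℂ} (hg : Continuous g) {a b : ℝ}
    (h0 : ∀ t ∈ uIcc a b, g t ≠ 0) :
    ∀ᶠ ε : ℝ in 𝓝[>] 0, ∀ t ∈ uIcc a b, g t ≠ ε ∧ g t ≠ -ε := by
  obtain ⟨m, hm, hmin⟩ := exists_pos_le_norm_of_ne_zero hg h0
  filter_upwards [Ioo_mem_nhdsGT (half_pos hm)] with ε hε t ht
  obtain ⟨h₁, h₂⟩ := half_le_norm_sub_and_add hε.1 hε.2 (hmin t ht)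
  constructor <;> intro h <;> rw [h] at h₁ h₂ <;> simp at h₁ h₂ <;> linarith

theorem tendsto_integral_windingJump_zero {g : ℝ → ℂ} {K : NNReal} (hg : LipschitzWith K g)
    {a b : ℝ} (h0 : ∀ t ∈ uIcc a b, g t ≠ 0) :
    Tendsto (fun ε : ℝ => ∫ t in a..b, windingJump g ε t) (𝓝[>] 0) (𝓝 0) := by
  obtain ⟨m, hm, hmin⟩ := exists_pos_le_norm_of_ne_zero hg.continuous h0
  have hlim : Tendsto (fun ε : ℝ => K * (2 * ε) / (m / 2 * (m / 2)) * |b - a|) (𝓝[>] 0) (𝓝 0) :=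
    tendsto_nhdsWithin_of_tendsto_nhds (Continuous.tendsto' (by fun_prop) _ _ (by simp))
  refine squeeze_zero_norm' ?_ hlim
  filter_upwards [Ioo_mem_nhdsGT (half_pos hm)] with ε hε
  refine intervalIntegral.norm_integral_le_of_norm_le_const fun t ht => ?_
  obtain ⟨h₁, h₂⟩ := half_le_norm_sub_and_add hε.1 hε.2 (hmin t (uIoc_subset_uIcc ht))
  have hp : 0 < m / 2 := half_pos hm
  have hne₁ : g t - ε ≠ 0 := norm_pos_iff.1 (hp.trans_le h₁)
  have hne₂ : g t + ε ≠ 0 := norm_pos_iff.1 (hp.trans_le h₂)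
  have heq : windingJump g ε t = deriv g t * (2 * ε) / ((g t - ε) * (g t + ε)) := by
    unfold windingJump
    field_simp
    ring
  have hn : ‖(2 * ε : ℂ)‖ = 2 * ε := by simp [abs_of_pos hε.1]
  have hε0 := hε.1.le
  rw [heq, norm_div, norm_mul, hn, norm_mul]
  gcongr
  exact norm_deriv_le_of_lipschitz hg

theorem integral_windingJump_eq_log {g : ℝ → ℂ} {K : NNReal} (hg : LipschitzWith K g)
    {ε a b : ℝ} (h₁ : ∀ t ∈ uIcc a b, (ε : ℂ) - g t ∈ Complex.slitPlane)
    (h₂ : ∀ t ∈ uIcc a b, g t + ε ∈ Complex.slitPlane) :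
    ∫ t in a..b, windingJump g ε t =
      (Complex.log (ε - g b) - Complex.log (ε - g a)) -
        (Complex.log (g b + ε) - Complex.log (g a + ε)) := by
  have hl₁ : LipschitzWith K (fun t => (ε : ℂ) - g t) := by
    simpa using (LipschitzWith.const (ε : ℂ)).sub hg
  have hl₂ : LipschitzWith K (fun t => g t + (ε : ℂ)) := by
    simpa using hg.add (LipschitzWith.const (ε : ℂ))
  rw [← integral_deriv_div_eq_log_sub hl₁ h₁, ← integral_deriv_div_eq_log_sub hl₂ h₂,
    ← intervalIntegral.integral_sub
      (hl₁.intervalIntegrable_deriv_div hl₁.continuous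
        fun t ht => Complex.slitPlane_ne_zero (h₁ t ht))
      (hl₂.intervalIntegrable_deriv_div hl₂.continuous
        fun t ht => Complex.slitPlane_ne_zero (h₂ t ht))]
  congr 1
  ext t
  rw [windingJump, deriv_const_sub, deriv_add_const, ← neg_sub (g t) (ε : ℂ), neg_div_neg_eq]

/-- Near a parameter where `g` crosses the real axis downwards at `0`, the winding integrals around
`ε` and `-ε` differ by `2πi` in the limit. -/
theorem tendsto_integral_windingJump_of_im_signs {g : ℝ → ℂ} {K : NNReal}
    (hg : LipschitzWith K g) {a b t₀ : ℝ} (ha : a < t₀) (hb : t₀ < b) (h0 : g t₀ = 0)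
    (hl : ∀ t ∈ Ico a t₀, 0 < (g t).im) (hr : ∀ t ∈ Ioc t₀ b, (g t).im < 0) :
    Tendsto (fun ε : ℝ => ∫ t in a..b, windingJump g ε t) (𝓝[>] 0)
      (𝓝 (2 * Real.pi * Complex.I)) := by
  have hga := hl a ⟨le_rfl, ha⟩
  have hgb := hr b ⟨hb, le_rfl⟩
  have hcont : Tendsto (fun ε : ℝ => (ε : ℂ)) (𝓝[>] 0) (𝓝 0) :=
    tendsto_nhdsWithin_of_tendsto_nhds (Continuous.tendsto' (by fun_prop) _ _ (by simp))
  have hsub : ∀ z : ℂ, Tendsto (fun ε : ℝ => (ε : ℂ) - z) (𝓝[>] 0) (𝓝 (-z)) := fun z => by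
    simpa using hcont.sub_const z
  have hadd : ∀ z : ℂ, Tendsto (fun ε : ℝ => z + (ε : ℂ)) (𝓝[>] 0) (𝓝 z) := fun z => by
    simpa using hcont.const_add z
  have hlim := (((hsub (g b)).clog (.inr (by simpa using hgb.ne))).sub
    ((hsub (g a)).clog (.inr (by simpa using hga.ne')))).sub
    (((hadd (g b)).clog (.inr hgb.ne)).sub ((hadd (g a)).clog (.inr hga.ne')))
  have hval : (Complex.log (-g b) - Complex.log (-g a)) -
      (Complex.log (g b) - Complex.log (g a)) = 2 * Real.pi * Complex.I := by
    linear_combination Complex.log_neg_sub_log_of_im_neg hgb -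
      Complex.log_neg_sub_log_of_im_pos hga
  rw [hval] at hlim
  refine hlim.congr' ?_
  filter_upwards [self_mem_nhdsWithin] with ε hε
  have hε : 0 < ε := hε
  have him : ∀ t ∈ uIcc a b, g t = 0 ∨ (g t).im ≠ 0 := fun t ht => by
    rw [uIcc_of_le (ha.trans hb).le] at ht
    rcases lt_trichotomy t t₀ with h | rfl | h
    · exact .inr (hl t ⟨ht.1, h⟩).ne'
    · exact .inl h0
    · exact .inr (hr t ⟨h, ht.2⟩).ne
  refine (integral_windingJump_eq_log hg (fun t ht => ?_) fun t ht => ?_).symm <;>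
    rcases him t ht with h | h <;> rw [Complex.mem_slitPlane_iff] <;> simp [h, hε]

theorem exists_im_signs_of_hasDerivAt {g : ℝ → ℂ} {w : ℂ} {t₀ : ℝ} (hd : HasDerivAt g w t₀)
    (h0 : g t₀ = 0) (hw : w.im < 0) {r : ℝ} (hr : 0 < r) :
    ∃ δ > 0, δ < r ∧ (∀ t ∈ Ico (t₀ - δ) t₀, 0 < (g t).im) ∧
      ∀ t ∈ Ioc t₀ (t₀ + δ), (g t).im < 0 := by
  have him : HasDerivAt (fun t => (g t).im) w.im t₀ :=
    Complex.imCLM.hasFDerivAt.comp_hasDerivAt t₀ hd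
  have hslope := (hasDerivAt_iff_tendsto_slope.1 him).eventually_lt_const hw
  rw [eventually_nhdsWithin_iff, Metric.eventually_nhds_iff] at hslope
  obtain ⟨δ, hδ, hs⟩ := hslope
  refine ⟨min δ r / 2, by positivity, ?_, fun t ht => ?_, fun t ht => ?_⟩
  · linarith [min_le_right δ r]
  · have h := hs (y := t) (by
      rw [Real.dist_eq, abs_lt]
      constructor <;> linarith [ht.1, ht.2, min_le_left δ r]) ht.2.ne
    simp only [slope_def_field, h0, Complex.zero_im, sub_zero] at h
    exact (div_neg_iff.1 h).elim (fun h => h.1) fun h => absurd h.2 (by linarith [ht.2])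
  · have h := hs (y := t) (by
      rw [Real.dist_eq, abs_lt]
      constructor <;> linarith [ht.1, ht.2, min_le_left δ r]) ht.1.ne'
    simp only [slope_def_field, h0, Complex.zero_im, sub_zero] at h
    exact (div_neg_iff.1 h).elim (fun h => absurd h.2 (by linarith [ht.1])) fun h => h.1

theorem tendsto_integral_windingJump {g : ℝ → ℂ} {K : NNReal} (hg : LipschitzWith K g)
    {a b t₀ : ℝ} {w : ℂ} (ha : a < t₀) (hb : t₀ < b) (h0 : ∀ t ∈ Icc a b, g t = 0 ↔ t = t₀)
    (hd : HasDerivAt g w t₀) (hw : w.im < 0) :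
    Tendsto (fun ε : ℝ => ∫ t in a..b, windingJump g ε t) (𝓝[>] 0)
        (𝓝 (2 * Real.pi * Complex.I)) ∧
      ∀ᶠ ε : ℝ in 𝓝[>] 0, ∀ t ∈ Icc a b, g t ≠ ε ∧ g t ≠ -ε := by
  have hz : g t₀ = 0 := (h0 t₀ ⟨ha.le, hb.le⟩).2 rfl
  obtain ⟨δ, hδ, hδr, hl, hr⟩ := exists_im_signs_of_hasDerivAt hd hz hw
    (lt_min (sub_pos.2 ha) (sub_pos.2 hb))
  obtain ⟨hδa, hδb⟩ := lt_min_iff.1 hδr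
  have hle₁ : a ≤ t₀ - δ := by linarith
  have hle₂ : t₀ - δ ≤ t₀ + δ := by linarith
  have hle₃ : t₀ + δ ≤ b := by linarith
  have hne₁ : ∀ t ∈ uIcc a (t₀ - δ), g t ≠ 0 := fun t ht h => by
    rw [uIcc_of_le hle₁] at ht
    have := (h0 t ⟨ht.1, by linarith [ht.2]⟩).1 h
    linarith [ht.2]
  have hne₃ : ∀ t ∈ uIcc (t₀ + δ) b, g t ≠ 0 := fun t ht h => by
    rw [uIcc_of_le hle₃] at ht
    have := (h0 t ⟨by linarith [ht.1], ht.2⟩).1 h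
    linarith [ht.1]
  have hev₁ := eventually_ne_of_ne_zero hg.continuous hne₁
  have hev₃ := eventually_ne_of_ne_zero hg.continuous hne₃
  have hev₂ : ∀ᶠ ε : ℝ in 𝓝[>] 0, ∀ t ∈ uIcc (t₀ - δ) (t₀ + δ), g t ≠ ε ∧ g t ≠ -ε := by
    filter_upwards [self_mem_nhdsWithin] with ε hε t ht
    have hε : 0 < ε := hε
    rw [uIcc_of_le hle₂] at ht
    rcases lt_trichotomy t t₀ with h | rfl | h
    · have him := hl t ⟨ht.1, h⟩
      constructor <;> intro h <;> simp [h] at him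
    · rw [hz]
      constructor <;> intro h <;> simp [eq_comm] at h <;> linarith
    · have him := hr t ⟨h, ht.2⟩
      constructor <;> intro h <;> simp [h] at him
  constructor
  · have hsum := ((tendsto_integral_windingJump_zero hg hne₁).add
      (tendsto_integral_windingJump_of_im_signs hg (by linarith) (by linarith) hz hl hr)).add
      (tendsto_integral_windingJump_zero hg hne₃)
    rw [zero_add, add_zero] at hsum
    refine hsum.congr' ?_
    filter_upwards [hev₁, hev₂, hev₃] with ε h₁ h₂ h₃
    have i₁ := intervalIntegrable_windingJump hg h₁
    have i₂ := intervalIntegrable_windingJump hg h₂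
    have i₃ := intervalIntegrable_windingJump hg h₃
    rw [intervalIntegral.integral_add_adjacent_intervals i₁ i₂,
      intervalIntegral.integral_add_adjacent_intervals (i₁.trans i₂) i₃]
  · filter_upwards [hev₁, hev₂, hev₃] with ε h₁ h₂ h₃ t ht
    rw [uIcc_of_le hle₁] at h₁
    rw [uIcc_of_le hle₂] at h₂
    rw [uIcc_of_le hle₃] at h₃
    rcases le_total t (t₀ - δ) with h | h
    · exact h₁ t ⟨ht.1, h⟩
    · rcases le_total t (t₀ + δ) with h' | h'
      · exact h₂ t ⟨h, h'⟩
      · exact h₃ t ⟨h', ht.2⟩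

theorem winding_add_mul {γ : ℝ → ℂ} {x n : ℂ} (hn : n ≠ 0) (z : ℂ) :
    winding γ (x + z * n) = (2 * Real.pi * Complex.I)⁻¹ *
      ∫ t in (0 : ℝ)..1, deriv (fun s => (γ s - x) / n) t / ((γ t - x) / n - z) := by
  unfold winding
  congr 2
  ext t
  rw [deriv_div_const, deriv_sub_const, div_sub' hn, div_div_div_cancel_right₀ hn,
    mul_comm n z, sub_sub]

/-- Two passages of a closed curve through the same point, both from the same side of a common
line `ℝ n` to the other, are incompatible with winding numbers in `{0, 1}`. -/
theorem false_of_im_div_neg {γ : ℝ → ℂ} (hper : Function.Periodic γ 1) {K : NNReal}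
    (hlip : LipschitzWith K γ) (hw : ∀ x ∉ Set.range γ, winding γ x = 0 ∨ winding γ x = 1)
    {x : ℂ} {t₁ t₂ : ℝ} (ht₁ : t₁ ∈ Ico (0 : ℝ) 1) (ht₂ : t₂ ∈ Ico (0 : ℝ) 1) (hlt : t₁ < t₂)
    (hx₁ : γ t₁ = x) (hx₂ : γ t₂ = x)
    (hpre : ∀ t ∈ Ico (0 : ℝ) 1, γ t = x → t = t₁ ∨ t = t₂)
    {v₁ v₂ n : ℂ} (hd₁ : HasDerivAt γ v₁ t₁) (hd₂ : HasDerivAt γ v₂ t₂) (hn : n ≠ 0)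
    (hn₁ : (v₁ / n).im < 0) (hn₂ : (v₂ / n).im < 0) : False := by
  obtain ⟨hl₁, hu₁⟩ := ht₁
  obtain ⟨hl₂, hu₂⟩ := ht₂
  set g : ℝ → ℂ := fun t => (γ t - x) / n with hgdef
  have hgper : Function.Periodic g 1 := fun t => by simp only [hgdef, hper t]
  have hglip : LipschitzWith (‖n⁻¹‖₊ * (K + 0)) g := by
    have h := (lipschitzWith_smul n⁻¹).comp (hlip.sub (LipschitzWith.const x))
    have heq : g = (fun z : ℂ => n⁻¹ • z) ∘ (fun t => γ t - x) := by
      ext t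
      simp [hgdef, div_eq_inv_mul]
    rw [heq]
    exact h
  have hg0 : ∀ t, g t = 0 ↔ γ t = x := fun t => by simp [hgdef, hn, sub_eq_zero]
  have hgd₁ : HasDerivAt g (v₁ / n) t₁ := (hd₁.sub_const x).div_const n
  have hgd₂ : HasDerivAt g (v₂ / n) t₂ := (hd₂.sub_const x).div_const n
  set m := (t₁ + t₂) / 2 with hm
  set s := (t₁ + t₂ - 1) / 2 with hs
  obtain ⟨hlim₁, hev₁⟩ := tendsto_integral_windingJump hglip (a := s) (b := m) (t₀ := t₁)
    (by linarith) (by linarith) (fun t ht => by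
      rw [hg0]
      refine ⟨fun h => ?_, fun h => h ▸ hx₁⟩
      rcases le_or_gt 0 t with h0 | h0
      · rcases hpre t ⟨h0, by linarith [ht.2]⟩ h with h | h <;> linarith [ht.2]
      · rcases hpre (t + 1) ⟨by linarith [ht.1], by linarith⟩ (by rw [hper, h]) with h | h <;>
          linarith [ht.1]) hgd₁ hn₁
  obtain ⟨hlim₂, hev₂⟩ := tendsto_integral_windingJump hglip (a := m) (b := s + 1) (t₀ := t₂)
    (by linarith) (by linarith) (fun t ht => by
      rw [hg0]
      refine ⟨fun h => ?_, fun h => h ▸ hx₂⟩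
      rcases lt_or_ge t 1 with h1 | h1
      · rcases hpre t ⟨by linarith [ht.1], h1⟩ h with h | h <;> linarith [ht.1]
      · rcases hpre (t - 1) ⟨by linarith, by linarith [ht.2]⟩ (by rw [hper.sub_eq, h])
          with h | h <;> linarith [ht.2]) hgd₂ hn₂
  have hlim := ((hlim₁.add hlim₂).const_mul (2 * Real.pi * Complex.I)⁻¹).norm
  have hval : ‖(2 * Real.pi * Complex.I)⁻¹ *
      (2 * Real.pi * Complex.I + 2 * Real.pi * Complex.I)‖ = 2 := by
    rw [← two_mul, mul_left_comm, inv_mul_cancel₀ Complex.two_pi_I_ne_zero]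
    simp
  rw [hval] at hlim
  have hbound : (2 : ℝ) ≤ 1 := by
    refine le_of_tendsto hlim ?_
    filter_upwards [hev₁, hev₂] with ε h₁ h₂
    have hne : ∀ t, g t ≠ ε ∧ g t ≠ -ε := fun t => by
      obtain ⟨u, hu, heq⟩ := hgper.exists_mem_Ico one_pos t s
      rw [heq]
      rcases le_total u m with h | h
      · exact h₁ u ⟨hu.1, h⟩
      · exact h₂ u ⟨h, hu.2.le⟩
    have hnot : ∀ z : ℂ, (∀ t, g t ≠ z) → x + z * n ∉ Set.range γ := by
      rintro z hz ⟨t, ht⟩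
      exact hz t (by simp [hgdef, ht, hn])
    have hw₁ := hw _ (hnot ε fun t => (hne t).1)
    have hw₂ := hw _ (hnot (-ε) fun t => (hne t).2)
    have hderper : Function.Periodic (windingJump g ε) 1 := fun t => by
      have hd : deriv g (t + 1) = deriv g t := by
        rw [← deriv_comp_add_const]
        exact congrArg (deriv · t) (funext hgper)
      simp only [windingJump, hgper t, hd]
    have hc := hglip.continuous
    have hint : (2 * Real.pi * Complex.I)⁻¹ *
        ((∫ t in s..m, windingJump g ε t) + ∫ t in m..s + 1, windingJump g ε t) =
        winding γ (x + ε * n) - winding γ (x + -ε * n) := by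
      rw [intervalIntegral.integral_add_adjacent_intervals
          (intervalIntegrable_windingJump hglip fun t _ => hne t)
          (intervalIntegrable_windingJump hglip fun t _ => hne t),
        hderper.intervalIntegral_add_eq s 0, zero_add, winding_add_mul hn, winding_add_mul hn,
        ← mul_sub, ← intervalIntegral.integral_sub]
      · simp only [sub_neg_eq_add]
        rfl
      · exact hglip.intervalIntegrable_deriv_div (h := fun t => g t - ε) (by fun_prop)
          fun t _ => sub_ne_zero.2 (hne t).1
      · exact hglip.intervalIntegrable_deriv_div (h := fun t => g t - -ε) (by fun_prop)
          fun t _ => sub_ne_zero.2 (hne t).2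
    rw [hint]
    rcases hw₁ with h | h <;> rcases hw₂ with h' | h' <;> rw [h, h'] <;> norm_num
  norm_num at hbound

theorem im_div_I_mul_add_neg {v w : ℂ} (hvw : ‖v‖ = ‖w‖) (hne : v ≠ -w) :
    (v / (Complex.I * (v + w))).im < 0 := by
  have hsq : v.re * v.re + v.im * v.im = w.re * w.re + w.im * w.im := by
    rw [← Complex.normSq_apply, ← Complex.normSq_apply, Complex.normSq_eq_norm_sq,
      Complex.normSq_eq_norm_sq, hvw]
  have hn : Complex.I * (v + w) ≠ 0 :=
    mul_ne_zero Complex.I_ne_zero fun h => hne (eq_neg_of_add_eq_zero_left h)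
  have hpos : 0 < (v.re + w.re) * (v.re + w.re) + (v.im + w.im) * (v.im + w.im) := by
    simpa [Complex.normSq_apply] using
      Complex.normSq_pos.2 fun h => hne (eq_neg_of_add_eq_zero_left h)
  rw [Complex.div_im, ← sub_div]
  refine div_neg_of_neg_of_pos ?_ (Complex.normSq_pos.2 hn)
  simp
  nlinarith

/-- at a double point of a constant-speed Lipschitz closed curve whose
winding number takes only the values 0 and 1, the two tangent vectors are antiparallel:
γ'(t₁) = −γ'(t₂). -/
theorem stmt_4 (γ : ℝ → ℂ) (hper : Function.Periodic γ 1)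
    (K : NNReal) (hlip : LipschitzWith K γ)
    (c : ℝ) (hc : 0 < c) (hspeed : ∀ᵐ t : ℝ, ‖deriv γ t‖ = c)
    (hw : ∀ x ∉ Set.range γ, winding γ x = 0 ∨ winding γ x = 1)
    (x : ℂ) (t₁ t₂ : ℝ) (ht₁ : t₁ ∈ Ico (0:ℝ) 1) (ht₂ : t₂ ∈ Ico (0:ℝ) 1)
    (hne : t₁ ≠ t₂) (hx₁ : γ t₁ = x) (hx₂ : γ t₂ = x)
    (hpre : ∀ t ∈ Ico (0:ℝ) 1, γ t = x → t = t₁ ∨ t = t₂)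
    (v₁ v₂ : ℂ) (hd₁ : HasDerivAt γ v₁ t₁) (hd₂ : HasDerivAt γ v₂ t₂)
    (hv₁ : ‖v₁‖ = c) (hv₂ : ‖v₂‖ = c) :
    v₁ = -v₂ := by
  by_contra hanti
  have hv : ‖v₁‖ = ‖v₂‖ := hv₁.trans hv₂.symm
  have hn : Complex.I * (v₁ + v₂) ≠ 0 :=
    mul_ne_zero Complex.I_ne_zero fun h => hanti (eq_neg_of_add_eq_zero_left h)
  have hn₁ := im_div_I_mul_add_neg hv hanti
  have hn₂ := im_div_I_mul_add_neg hv.symm fun h => hanti (neg_eq_iff_eq_neg.2 h).symm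
  rw [add_comm v₂ v₁] at hn₂
  rcases hne.lt_or_gt with hlt | hlt
  · exact false_of_im_div_neg hper hlip hw ht₁ ht₂ hlt hx₁ hx₂ hpre hd₁ hd₂ hn hn₁ hn₂
  · exact false_of_im_div_neg hper hlip hw ht₂ ht₁ hlt hx₂ hx₁
      (fun t ht h => (hpre t ht h).symm) hd₂ hd₁ hn hn₂ hn₁
end

section
/- Let γ : ℝ/ℤ → ℝ² be a Lipschitz closed curve with constant speed such that ω(γ, x) ∈ {0, 1} for all x ∉ γ(ℝ/ℤ). Suppose x ∈ γ(ℝ/ℤ) has finitely many preimages t₁, …, t_m with m ≥ 2, and γ is differentiable with nonzero derivative at each t_i. Then there exist indices k ≠ l with γ'(t_k) ≠ γ'(t_l). -/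
open MeasureTheory Set

open Filter Topology

/-- Fundamental theorem of calculus for `F ∘ g` with `g` Lipschitz and `F` analytic along `g`. -/
lemma LipschitzWith.integral_deriv_mul_deriv_comp {g : ℝ → ℂ} {K : NNReal}
    (hg : LipschitzWith K g) {F : ℂ → ℂ} {a b : ℝ} (hab : a ≤ b)
    (hF : ∀ t ∈ Icc a b, AnalyticAt ℂ F (g t)) :
    ∫ t in a..b, deriv g t * deriv F (g t) = F (g b) - F (g a) := by
  obtain ⟨C, hC⟩ : ∃ C, LipschitzOnWith C (F ∘ g) (Icc a b) := by
    refine LocallyLipschitzOn.exists_lipschitzOnWith_of_compact isCompact_Icc fun t ht => ?_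
    obtain ⟨C, s, hs, hl⟩ := ((hF t ht).contDiffAt (n := 1)).exists_lipschitzOnWith
    exact ⟨C * K, g ⁻¹' s, mem_nhdsWithin_of_mem_nhds (hg.continuous.continuousAt hs),
      hl.comp hg.lipschitzOnWith fun _ h => h⟩
  have hder : ∀ᵐ t : ℝ, t ∈ Icc a b →
      HasDerivAt (F ∘ g) (deriv g t * deriv F (g t)) t := by
    filter_upwards [hg.ae_differentiableAt_real] with t ht hmem
    rw [mul_comm]
    exact (hF t hmem).differentiableAt.hasDerivAt.comp t ht.hasDerivAt
  have hint : IntervalIntegrable (fun t => deriv g t * deriv F (g t)) volume a b := by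
    refine IntervalIntegrable.mul_continuousOn ?_ fun t ht => ?_
    · refine (intervalIntegrable_const (c := (K : ℝ))).mono_fun
        (measurable_deriv g).aestronglyMeasurable (Eventually.of_forall fun t => ?_)
      simpa using norm_deriv_le_of_lipschitz hg
    · rw [uIcc_of_le hab] at ht
      exact ((hF t ht).deriv.continuousAt.comp hg.continuous.continuousAt).continuousWithinAt
  have key : ∀ L : ℂ →L[ℝ] ℝ,
      L (∫ t in a..b, deriv g t * deriv F (g t)) = L (F (g b) - F (g a)) := fun L => by
    have hac : AbsolutelyContinuousOnInterval (L ∘ F ∘ g) a b :=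
      ((L.lipschitz.lipschitzOnWith (s := univ)).comp hC
        (mapsTo_univ _ _)).mono (uIcc_of_le hab).subset |>.absolutelyContinuousOnInterval
    have := hac.integral_deriv_eq_sub
    rw [map_sub, ← L.intervalIntegral_comp_comm hint]
    refine Eq.trans (intervalIntegral.integral_congr_ae ?_) this
    filter_upwards [hder] with t ht hmem
    rw [uIoc_of_le hab] at hmem
    exact (L.hasFDerivAt.comp_hasDerivAt t (ht (Ioc_subset_Icc_self hmem))).deriv.symm
  exact Complex.ext (key Complex.reCLM) (key Complex.imCLM)

lemma cayley_im (w : ℂ) (r : ℝ) :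
    ((r * Complex.I - w) / (r * Complex.I + w)).im =
      2 * r * w.re / Complex.normSq (r * Complex.I + w) := by
  rw [Complex.div_im]
  simp
  ring

lemma cayley_mem_slitPlane {w : ℂ} {r : ℝ} (hr : 0 < r) (hw : w = 0 ∨ w.re ≠ 0) :
    r * Complex.I + w ≠ 0 ∧
      (r * Complex.I - w) / (r * Complex.I + w) ∈ Complex.slitPlane := by
  have hr' : (r : ℂ) * Complex.I ≠ 0 := by simp [hr.ne']
  rcases hw with rfl | hw
  · simp only [sub_zero, add_zero]
    exact ⟨hr', by simp [div_self hr']⟩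
  · have hne : r * Complex.I + w ≠ 0 := fun h => hw (by simpa using congrArg Complex.re h)
    refine ⟨hne, Or.inr ?_⟩
    rw [cayley_im]
    have := (Complex.normSq_pos.2 hne).ne'
    positivity

lemma tendsto_cayley {w : ℂ} (hw : w ≠ 0) :
    Tendsto (fun r : ℝ => (r * Complex.I - w) / (r * Complex.I + w)) (𝓝[>] 0) (𝓝 (-1)) := by
  have : ContinuousAt (fun r : ℝ => (r * Complex.I - w) / (r * Complex.I + w)) 0 := by
    refine ContinuousAt.div (by fun_prop) (by fun_prop) (by simpa using hw)
  have h := this.tendsto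
  simp only [Complex.ofReal_zero, zero_mul, zero_sub, zero_add, neg_div, div_self hw] at h
  exact h.mono_left nhdsWithin_le_nhds

lemma tendsto_log_cayley_of_re_pos {w : ℂ} (hw : 0 < w.re) :
    Tendsto (fun r : ℝ => Complex.log ((r * Complex.I - w) / (r * Complex.I + w)))
      (𝓝[>] 0) (𝓝 (Real.pi * Complex.I)) := by
  have hw0 : w ≠ 0 := fun h => by simp [h] at hw
  have h := (Complex.tendsto_log_nhdsWithin_im_nonneg_of_re_neg_of_im_zero
    (z := -1) (by simp) (by simp)).comp
    (tendsto_nhdsWithin_iff.2 ⟨tendsto_cayley hw0, by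
      filter_upwards [self_mem_nhdsWithin] with r (hr : 0 < r)
      rw [cayley_im]
      have := Complex.normSq_nonneg (r * Complex.I + w)
      positivity⟩)
  simpa [Function.comp_def] using h

lemma tendsto_log_cayley_of_re_neg {w : ℂ} (hw : w.re < 0) :
    Tendsto (fun r : ℝ => Complex.log ((r * Complex.I - w) / (r * Complex.I + w)))
      (𝓝[>] 0) (𝓝 (-(Real.pi * Complex.I))) := by
  have hw0 : w ≠ 0 := fun h => by simp [h] at hw
  have h := (Complex.tendsto_log_nhdsWithin_im_neg_of_re_neg_of_im_zero
    (z := -1) (by simp) (by simp)).comp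
    (tendsto_nhdsWithin_iff.2 ⟨tendsto_cayley hw0, by
      filter_upwards [self_mem_nhdsWithin] with r (hr : 0 < r)
      rw [cayley_im]
      have hne := (cayley_mem_slitPlane hr (Or.inr hw.ne)).1
      exact div_neg_of_neg_of_pos (by nlinarith) (Complex.normSq_pos.2 hne)⟩)
  simpa [Function.comp_def] using h

/-- The integrand of `2πi (winding g (r i) - winding g (-r i))`. -/
noncomputable def jumpIntegrand (g : ℝ → ℂ) (r t : ℝ) : ℂ :=
  deriv g t / (g t - r * Complex.I) - deriv g t / (g t - -(r * Complex.I))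

lemma analyticAt_log_cayley {w : ℂ} {r : ℝ} (hr : 0 < r) (hw : w = 0 ∨ w.re ≠ 0) :
    AnalyticAt ℂ
      (fun z => Complex.log ((r * Complex.I - z) / (r * Complex.I + z))) w := by
  obtain ⟨h1, h2⟩ := cayley_mem_slitPlane hr hw
  exact ((analyticAt_const.sub analyticAt_id).div (analyticAt_const.add analyticAt_id) h1).clog h2

lemma deriv_log_cayley {w : ℂ} {r : ℝ} (hr : 0 < r) (hw : w = 0 ∨ w.re ≠ 0) :
    deriv (fun z => Complex.log ((r * Complex.I - z) / (r * Complex.I + z))) w =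
      (w - r * Complex.I)⁻¹ - (w - -(r * Complex.I))⁻¹ := by
  obtain ⟨h1, h2⟩ := cayley_mem_slitPlane hr hw
  have h3 : r * Complex.I - w ≠ 0 := fun h => by
    rw [h, zero_div] at h2
    exact Complex.slitPlane_ne_zero h2 rfl
  have h4 : w - r * Complex.I ≠ 0 := fun h => h3 (by linear_combination -h)
  have h5 : w - -(r * Complex.I) ≠ 0 := fun h => h1 (by linear_combination h)
  have hd := ((((hasDerivAt_id w).const_sub (r * Complex.I)).div
    ((hasDerivAt_id w).const_add (r * Complex.I)) h1).clog h2).deriv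
  simp only [Pi.div_apply, id] at hd
  refine Eq.trans hd ?_
  field_simp
  ring

lemma tendsto_integral_jumpIntegrand {g : ℝ → ℂ} {K : NNReal} (hg : LipschitzWith K g)
    {a b s : ℝ} (has : a < s) (hsb : s < b) (hs : g s = 0)
    (hneg : ∀ t ∈ Ico a s, (g t).re < 0) (hpos : ∀ t ∈ Ioc s b, 0 < (g t).re) :
    Tendsto (fun r => ∫ t in Ioc a b, jumpIntegrand g r t) (𝓝[>] 0)
      (𝓝 (2 * Real.pi * Complex.I)) := by
  have hU : ∀ t ∈ Icc a b, g t = 0 ∨ (g t).re ≠ 0 := fun t ht => by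
    rcases lt_trichotomy t s with h | rfl | h
    · exact Or.inr (hneg t ⟨ht.1, h⟩).ne
    · exact Or.inl hs
    · exact Or.inr (hpos t ⟨h, ht.2⟩).ne'
  have hab : a ≤ b := (has.trans hsb).le
  have hlim := (tendsto_log_cayley_of_re_pos (hpos b ⟨hsb, le_rfl⟩)).sub
    (tendsto_log_cayley_of_re_neg (hneg a ⟨le_rfl, has⟩))
  have h2 : (Real.pi : ℂ) * Complex.I - -(Real.pi * Complex.I) = 2 * Real.pi * Complex.I := by ring
  rw [h2] at hlim
  refine hlim.congr' ?_
  filter_upwards [self_mem_nhdsWithin] with r (hr : 0 < r)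
  rw [← hg.integral_deriv_mul_deriv_comp hab fun t ht => analyticAt_log_cayley hr (hU t ht),
    intervalIntegral.integral_of_le hab]
  refine setIntegral_congr_fun measurableSet_Ioc fun t ht => ?_
  simp only [jumpIntegrand]
  rw [deriv_log_cayley hr (hU t (Ioc_subset_Icc_self ht))]
  ring

lemma measurable_jumpIntegrand {g : ℝ → ℂ} (hg : Continuous g) (r : ℝ) :
    Measurable (jumpIntegrand g r) :=
  ((measurable_deriv g).div (hg.measurable.sub_const _)).sub
    ((measurable_deriv g).div (hg.measurable.sub_const _))

lemma tendsto_integral_jumpIntegrand_zero {g : ℝ → ℂ} {K : NNReal} (hg : LipschitzWith K g)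
    {S : Set ℝ} (hS : MeasurableSet S) (hfin : volume S ≠ ⊤) {m : ℝ} (hm : 0 < m)
    (hgm : ∀ t ∈ S, m ≤ ‖g t‖) :
    Tendsto (fun r => ∫ t in S, jumpIntegrand g r t) (𝓝[>] 0) (𝓝 0) := by
  have hlow : ∀ t ∈ S, ∀ z : ℂ, ‖z‖ < m / 2 → m / 2 ≤ ‖g t - z‖ := fun t ht z hz => by
    have := norm_sub_norm_le (g t) z
    linarith [hgm t ht]
  have hK : ∀ t, ‖deriv g t‖ ≤ K := fun t => norm_deriv_le_of_lipschitz hg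
  have hbd : ∀ t ∈ S, ∀ z : ℂ, ‖z‖ < m / 2 → ‖deriv g t / (g t - z)‖ ≤ K / (m / 2) :=
    fun t ht z hz => by
      rw [norm_div]
      exact div_le_div₀ K.2 (hK t) (by positivity) (hlow t ht z hz)
  have : Tendsto (fun r => ∫ t in S, jumpIntegrand g r t) (𝓝[>] 0) (𝓝 (∫ t in S, (0 : ℂ))) := by
    refine tendsto_integral_filter_of_dominated_convergence
      (fun _ => K / (m / 2) + K / (m / 2))
      (Eventually.of_forall fun r => (measurable_jumpIntegrand hg.continuous r).aestronglyMeasurable)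
      ?_ ?_ ?_
    · filter_upwards [Ioo_mem_nhdsGT (half_pos hm)] with r hr
      filter_upwards [ae_restrict_mem hS] with t ht
      have hr' : ‖(r : ℂ) * Complex.I‖ < m / 2 := by simpa [abs_of_pos hr.1] using hr.2
      exact (norm_sub_le _ _).trans
        (add_le_add (hbd t ht _ hr') (hbd t ht _ (by rwa [norm_neg])))
    · exact integrableOn_const hfin
    · filter_upwards [ae_restrict_mem hS] with t ht
      have hne : g t ≠ 0 := norm_pos_iff.1 (hm.trans_le (hgm t ht))
      have : ContinuousAt (fun r : ℝ => jumpIntegrand g r t) 0 := by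
        unfold jumpIntegrand
        exact (continuousAt_const.div (by fun_prop) (by simpa using hne)).sub
          (continuousAt_const.div (by fun_prop) (by simpa using hne))
      have h := this.tendsto.mono_left (nhdsWithin_le_nhds (s := Ioi 0))
      simpa [jumpIntegrand] using h
  simpa using this

lemma eventually_re_sign {g : ℝ → ℂ} {s : ℝ} (hs : g s = 0) (hd : HasDerivAt g 1 s) :
    ∀ᶠ δ in 𝓝[>] (0 : ℝ), (∀ t ∈ Ico (s - δ) s, (g t).re < 0) ∧
      ∀ t ∈ Ioc s (s + δ), 0 < (g t).re := by
  have hre : HasDerivAt (fun t => (g t).re) 1 s := by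
    have := Complex.reCLM.hasFDerivAt.comp_hasDerivAt s hd
    rwa [Complex.reCLM_apply, Complex.one_re] at this
  have hslope := hasDerivAt_iff_tendsto_slope.1 hre
  have hev := hslope.eventually (lt_mem_nhds one_pos)
  rw [eventually_nhdsWithin_iff, Metric.eventually_nhds_iff] at hev
  obtain ⟨ε, hε, h⟩ := hev
  filter_upwards [Ioo_mem_nhdsGT hε] with δ hδ
  refine ⟨fun t ht => ?_, fun t ht => ?_⟩
  · have := h (y := t) (by rw [Real.dist_eq, abs_lt]; constructor <;> linarith [ht.1, ht.2, hδ.2])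
      ht.2.ne
    rw [slope_def_field, hs, Complex.zero_re, sub_zero] at this
    by_contra! hc
    exact absurd this (not_lt.2 (div_nonpos_of_nonneg_of_nonpos hc (by linarith [ht.2])))
  · have := h (y := t) (by rw [Real.dist_eq, abs_lt]; constructor <;> linarith [ht.1, ht.2, hδ.2])
      ht.1.ne'
    rw [slope_def_field, hs, Complex.zero_re, sub_zero] at this
    exact (div_pos_iff_of_pos_right (by linarith [ht.1])).1 this

lemma winding_sub_winding {g : ℝ → ℂ} (hper : Function.Periodic g 1) {K : NNReal}
    (hg : LipschitzWith K g) {r : ℝ} (h1 : (r * Complex.I : ℂ) ∉ range g)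
    (h2 : -(r * Complex.I : ℂ) ∉ range g) (a : ℝ) :
    winding g (r * Complex.I) - winding g (-(r * Complex.I)) =
        (2 * Real.pi * Complex.I)⁻¹ * ∫ t in Ioc a (a + 1), jumpIntegrand g r t ∧
      IntegrableOn (jumpIntegrand g r) (Ioc a (a + 1)) := by
  have hint : ∀ z ∉ range g, ∀ a b : ℝ,
      IntervalIntegrable (fun t => deriv g t / (g t - z)) volume a b := fun z hz a b => by
    simp only [div_eq_mul_inv]
    refine IntervalIntegrable.mul_continuousOn ?_ ?_
    · refine (intervalIntegrable_const (c := (K : ℝ))).mono_fun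
        (measurable_deriv g).aestronglyMeasurable (Eventually.of_forall fun t => ?_)
      simpa using norm_deriv_le_of_lipschitz hg
    · exact ((hg.continuous.sub continuous_const).inv₀
        fun t h => hz ⟨t, sub_eq_zero.1 h⟩).continuousOn
  have hJ : Function.Periodic (jumpIntegrand g r) 1 := fun t => by
    have : deriv g (t + 1) = deriv g t := by
      rw [← deriv_comp_add_const]
      exact congrArg (fun f => deriv f t) (funext hper)
    simp only [jumpIntegrand, this, hper t]
  constructor
  · rw [winding, winding, ← mul_sub, ← intervalIntegral.integral_sub (hint _ h1 _ _)
      (hint _ h2 _ _), ← intervalIntegral.integral_of_le (by linarith),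
      hJ.intervalIntegral_add_eq a 0, zero_add]
    rfl
  · rw [← intervalIntegrable_iff_integrableOn_Ioc_of_le (by linarith)]
    exact (hint _ h1 _ _).sub (hint _ h2 _ _)

/-- If all the branches of a closed curve through `0` have tangent vector `1` there, then the
winding number jumps by the number of branches across `0` in the normal direction. -/
lemma tendsto_winding_sub_winding {g : ℝ → ℂ} (hper : Function.Periodic g 1) {K : NNReal}
    (hg : LipschitzWith K g) {T : Finset ℝ} (hT : (T : Set ℝ) ⊆ Ico (0 : ℝ) 1)
    (hpre : ∀ t ∈ Ico (0 : ℝ) 1, (g t = 0 ↔ t ∈ T)) (hd : ∀ t ∈ T, HasDerivAt g 1 t) :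
    (∀ᶠ r : ℝ in 𝓝[>] 0, (r * Complex.I : ℂ) ∉ range g ∧ -(r * Complex.I : ℂ) ∉ range g) ∧
      Tendsto (fun r : ℝ => winding g (r * Complex.I) - winding g (-(r * Complex.I)))
        (𝓝[>] 0) (𝓝 (T.card : ℂ)) := by
  have hT0 : ∀ s ∈ T, g s = 0 := fun s hs => (hpre s (hT hs)).2 hs
  obtain ⟨δ, hsign, hroom, hsep, hδ⟩ : ∃ δ : ℝ,
      (∀ s ∈ T, (∀ t ∈ Ico (s - δ) s, (g t).re < 0) ∧ ∀ t ∈ Ioc s (s + δ), 0 < (g t).re) ∧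
      (∀ s ∈ T, 2 * δ < 1 - s) ∧ (∀ s ∈ T, ∀ s' ∈ T, s ≠ s' → 2 * δ < |s - s'|) ∧
      δ ∈ Ioo (0 : ℝ) (1 / 2) := by
    have hsmall : ∀ y : ℝ, 0 < y → ∀ᶠ δ in 𝓝[>] (0 : ℝ), 2 * δ < y := fun y hy => by
      filter_upwards [Ioo_mem_nhdsGT (half_pos hy)] with δ hδ
      linarith [hδ.2]
    refine Eventually.exists (f := 𝓝[>] (0 : ℝ)) (.and ?_ (.and ?_ (.and ?_ ?_)))
    · exact (eventually_all_finset T).2 fun s hs => eventually_re_sign (hT0 s hs) (hd s hs)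
    · exact (eventually_all_finset T).2 fun s hs => hsmall _ (sub_pos.2 (hT hs).2)
    · refine (eventually_all_finset T).2 fun s _ => (eventually_all_finset T).2 fun s' _ => ?_
      by_cases h : s = s'
      · simp [h]
      · filter_upwards [hsmall _ (abs_pos.2 (sub_ne_zero.2 h))] with δ hδ _ using hδ
    · exact Ioo_mem_nhdsGT (by norm_num)
  obtain ⟨hδ0, hδ1⟩ := hδ
  have hzero : ∀ t ∈ Icc (-δ) (-δ + 1), g t = 0 → t ∈ T := fun t ht h0 => by
    rcases le_or_gt 0 t with h | h
    · exact (hpre t ⟨h, by linarith [ht.2]⟩).1 h0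
    · have hmem : t + 1 ∈ T := (hpre (t + 1) ⟨by linarith [ht.1], by linarith⟩).1 (by rw [hper, h0])
      linarith [hroom _ hmem, ht.1]
  obtain ⟨m, hm, hgm⟩ : ∃ m > 0, ∀ t ∈ Icc (-δ) (-δ + 1) \ ⋃ s ∈ T, Ioo (s - δ) (s + δ),
      m ≤ ‖g t‖ := by
    refine IsCompact.exists_forall_le' (isCompact_Icc.diff
      (isOpen_biUnion fun s _ => isOpen_Ioo)) hg.continuous.norm.continuousOn fun t ht => ?_
    refine norm_pos_iff.2 fun h => ht.2 ?_
    exact mem_biUnion (hzero t ht.1 h) ⟨by linarith, by linarith⟩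
  have hrange : ∀ᶠ r : ℝ in 𝓝[>] 0,
      (r * Complex.I : ℂ) ∉ range g ∧ -(r * Complex.I : ℂ) ∉ range g := by
    filter_upwards [Ioo_mem_nhdsGT hm] with r hr
    have key : ∀ z : ℂ, z.re = 0 → ‖z‖ = r → z ∉ range g := by
      rintro _ hre hn ⟨t', rfl⟩
      obtain ⟨t, ht, hgt⟩ := hper.exists_mem_Ico one_pos t' (-δ)
      rw [hgt] at hre hn
      by_cases hU : t ∈ ⋃ s ∈ T, Ioo (s - δ) (s + δ)
      · obtain ⟨s, hs, hts⟩ := mem_iUnion₂.1 hU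
        rcases lt_trichotomy t s with h | rfl | h
        · exact ((hsign s hs).1 t ⟨hts.1.le, h⟩).ne hre
        · rw [hT0 t hs, norm_zero] at hn
          exact hr.1.ne hn
        · exact ((hsign s hs).2 t ⟨h, hts.2.le⟩).ne' hre
      · have := hgm t ⟨Ico_subset_Icc_self ht, hU⟩
        linarith [hr.2]
    exact ⟨key _ (by simp) (by simp [abs_of_pos hr.1]), key _ (by simp) (by simp [abs_of_pos hr.1])⟩
  refine ⟨hrange, ?_⟩
  set B : Set ℝ := ⋃ s ∈ T, Ioc (s - δ) (s + δ) with hB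
  have hBm : MeasurableSet B := T.measurableSet_biUnion fun _ _ => measurableSet_Ioc
  have hBsub : B ⊆ Ioc (-δ) (-δ + 1) := iUnion₂_subset fun s hs =>
    Ioc_subset_Ioc (by linarith [(hT hs).1]) (by linarith [hroom s hs])
  have hlim : Tendsto (fun r => (2 * Real.pi * Complex.I)⁻¹ *
      ((∑ s ∈ T, ∫ t in Ioc (s - δ) (s + δ), jumpIntegrand g r t) +
        ∫ t in Ioc (-δ) (-δ + 1) \ B, jumpIntegrand g r t)) (𝓝[>] 0)
      (𝓝 ((2 * Real.pi * Complex.I)⁻¹ * (∑ s ∈ T, 2 * Real.pi * Complex.I + 0))) := by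
    refine Tendsto.const_mul _ (Tendsto.add (tendsto_finsetSum _ fun s hs => ?_) ?_)
    · exact tendsto_integral_jumpIntegrand hg (by linarith) (by linarith) (hT0 s hs)
        (hsign s hs).1 (hsign s hs).2
    · refine tendsto_integral_jumpIntegrand_zero hg (measurableSet_Ioc.diff hBm)
        (measure_ne_top_of_subset sdiff_subset (by simp)) hm fun t ht => hgm t ⟨?_, ?_⟩
      · exact Ioc_subset_Icc_self ht.1
      · exact fun h => ht.2 (iUnion₂_mono (fun _ _ => Ioo_subset_Ioc_self) h)
  have hcard : (2 * Real.pi * Complex.I)⁻¹ * (∑ s ∈ T, 2 * Real.pi * Complex.I + 0) =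
      (T.card : ℂ) := by
    rw [Finset.sum_const, nsmul_eq_mul, add_zero]
    field_simp [Complex.two_pi_I_ne_zero]
  rw [hcard] at hlim
  refine hlim.congr' ?_
  filter_upwards [hrange] with r hr
  obtain ⟨heq, hint⟩ := winding_sub_winding hper hg hr.1 hr.2 (-δ)
  rw [heq, ← integral_inter_add_sdiff hBm hint, inter_eq_self_of_subset_right hBsub, hB,
    integral_biUnion_finset T (fun _ _ => measurableSet_Ioc)]
  · intro s hs s' hs' hne
    refine disjoint_left.2 fun t ht ht' => ?_
    have := hsep s hs s' hs' hne
    rcases abs_cases (s - s') with h | h <;> linarith [ht.1, ht.2, ht'.1, ht'.2]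
  · exact fun s hs => hint.mono_set ((subset_biUnion_of_mem (u := fun s => Ioc (s - δ) (s + δ))
      hs).trans hBsub)

lemma winding_affine {γ : ℝ → ℂ} {u : ℂ} (hu : u ≠ 0) (x z : ℂ) :
    winding (fun t => (γ t - x) / u) z = winding γ (x + u * z) := by
  unfold winding
  congr 1
  refine intervalIntegral.integral_congr fun t _ => ?_
  simp only [deriv_div_const, deriv_sub_const]
  rw [div_div, mul_sub, mul_div_cancel₀ _ hu, sub_sub]

/-- at a multiple point (m ≥ 2 preimages in a fundamental domain) of a
constant-speed Lipschitz closed curve whose winding number takes only the values 0 and 1,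
the tangent vectors at the preimages cannot all coincide. -/
theorem stmt_5 (γ : ℝ → ℂ) (hper : Function.Periodic γ 1)
    (K : NNReal) (hlip : LipschitzWith K γ)
    (c : ℝ) (hc : 0 < c) (hspeed : ∀ᵐ t : ℝ, ‖deriv γ t‖ = c)
    (hw : ∀ x ∉ Set.range γ, winding γ x = 0 ∨ winding γ x = 1)
    (x : ℂ) (T : Finset ℝ) (hT : (T : Set ℝ) ⊆ Ico (0:ℝ) 1) (hcard : 2 ≤ T.card)
    (hpre : ∀ t ∈ Ico (0:ℝ) 1, (γ t = x ↔ t ∈ T))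
    (v : ℝ → ℂ) (hd : ∀ t ∈ T, HasDerivAt γ (v t) t) (hv : ∀ t ∈ T, v t ≠ 0) :
    ∃ k ∈ T, ∃ l ∈ T, k ≠ l ∧ v k ≠ v l := by
  by_contra! hall
  obtain ⟨s₀, hs₀⟩ : T.Nonempty := Finset.card_pos.1 (by omega)
  set u := v s₀ with hu_def
  have hu : u ≠ 0 := hv s₀ hs₀
  have hvu : ∀ t ∈ T, v t = u := fun t ht => by
    by_cases h : t = s₀
    · rw [h]
    · exact hall t ht s₀ hs₀ h
  set g : ℝ → ℂ := fun t => (γ t - x) / u with hg_def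
  have hg : LipschitzWith (K * ‖u⁻¹‖₊) g := LipschitzWith.of_dist_le_mul fun a b => by
    have := hlip.dist_le_mul a b
    rw [dist_eq_norm] at this ⊢
    have hab : g a - g b = (γ a - γ b) * u⁻¹ := by simp only [hg_def]; ring
    rw [hab, norm_mul, NNReal.coe_mul, coe_nnnorm]
    calc _ ≤ K * dist a b * ‖u⁻¹‖ := by gcongr
      _ = _ := by ring
  obtain ⟨hrange, hlim⟩ := tendsto_winding_sub_winding (g := g) (T := T)
    (fun t => by simp only [hg_def, hper t]) hg hT
    (fun t ht => by simpa [hg_def, hu, sub_eq_zero] using hpre t ht)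
    (fun t ht => by
      have h := ((hd t ht).sub_const x).div_const u
      rwa [hvu t ht, div_self hu] at h)
  have hw' : ∀ z ∉ range g, winding g z = 0 ∨ winding g z = 1 := fun z hz => by
    rw [winding_affine hu]
    refine hw _ fun ⟨t, ht⟩ => hz ⟨t, ?_⟩
    simp only [hg_def, ht]
    field_simp
    ring
  have hle : (T.card : ℂ).re ≤ 1 := by
    refine le_of_tendsto ((Complex.continuous_re.tendsto _).comp hlim) ?_
    filter_upwards [hrange] with r hr
    rcases hw' _ hr.1 with h1 | h1 <;> rcases hw' _ hr.2 with h2 | h2 <;> simp [h1, h2]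
  rw [Complex.natCast_re] at hle
  have : T.card ≤ 1 := by exact_mod_cast hle
  omega
end

section
/- Let γ : ℝ/ℤ → ℝ² be a Lipschitz closed curve with ω(γ, x) = 0 for every x ∉ γ(ℝ/ℤ). Then for H¹-almost every x ∈ γ(ℝ/ℤ), the number of preimages #γ^{−1}(x) is even; in particular #γ^{−1}(x) ≥ 2 for H¹-a.e. x ∈ γ(ℝ/ℤ). Consequently, ∫_{ℝ/ℤ} |γ'(t)| dt = ∫_{γ(ℝ/ℤ)} #γ^{−1}(x) dH¹(x) ≥ 2 H¹(γ(ℝ/ℤ)). -/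
open MeasureTheory Set

section

open Filter Topology
open scoped NNReal ENNReal

namespace LipschitzWith

variable {γ : ℝ → ℂ} {K : ℝ≥0}

theorem locallyIntegrable_deriv (hlip : LipschitzWith K γ) : LocallyIntegrable (deriv γ) := by
  refine (locallyIntegrable_const (K : ℝ)).mono (aestronglyMeasurable_deriv γ _) ?_
  filter_upwards with t
  simpa using norm_deriv_le_of_lipschitz hlip

theorem integrable_deriv_restrict_Ico (hlip : LipschitzWith K γ) (a b : ℝ) :
    Integrable (deriv γ) (volume.restrict (Ico a b)) :=
  (hlip.locallyIntegrable_deriv.integrableOn_isCompact isCompact_Icc).mono_set Ico_subset_Icc_self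

theorem intervalIntegrable_deriv_s13 (hlip : LipschitzWith K γ) (a b : ℝ) :
    IntervalIntegrable (deriv γ) volume a b :=
  intervalIntegrable_iff.mpr <|
    (hlip.locallyIntegrable_deriv.integrableOn_isCompact isCompact_uIcc).mono_set
      uIoc_subset_uIcc

/-- The fundamental theorem of calculus for Lipschitz curves. -/
theorem integral_deriv_eq_sub (hlip : LipschitzWith K γ) (a b : ℝ) :
    ∫ t in a..b, deriv γ t = γ b - γ a := by
  have hbound : LipschitzWith K (fun x => ∫ t in a..x, deriv γ t) := by
    refine LipschitzWith.of_dist_le_mul fun x y => ?_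
    rw [dist_eq_norm, intervalIntegral.integral_interval_sub_left
      (hlip.intervalIntegrable_deriv_s13 a x) (hlip.intervalIntegrable_deriv_s13 a y), Real.dist_eq]
    exact intervalIntegral.norm_integral_le_of_norm_le_const
      fun t _ => norm_deriv_le_of_lipschitz hlip
  have hac : AbsolutelyContinuousOnInterval
      (fun x => γ x - ∫ t in a..x, deriv γ t) a b :=
    hlip.lipschitzOnWith.absolutelyContinuousOnInterval.sub
      hbound.lipschitzOnWith.absolutelyContinuousOnInterval
  obtain ⟨C, hC⟩ := hac.const_of_ae_hasDerivAt_zero (by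
    filter_upwards [hlip.ae_differentiableAt_real,
      _root_.LocallyIntegrable.ae_hasDerivAt_integral hlip.locallyIntegrable_deriv] with x hx hx' _
    exact sub_self (deriv γ x) ▸ hx.hasDerivAt.sub (hx' a))
  have h₁ := hC a left_mem_uIcc
  have h₂ := hC b right_mem_uIcc
  rw [intervalIntegral.integral_same, sub_zero] at h₁
  rw [h₁, ← h₂]
  ring

/-- The image of a measurable set under a Lipschitz curve has length at most the integral of the
speed over that set. -/
theorem hausdorffMeasure_image_le_lintegral_deriv (hlip : LipschitzWith K γ) {s : Set ℝ}
    (hs : MeasurableSet s) :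
    μH[1] (γ '' s) ≤ ∫⁻ t in s, ‖deriv γ t‖ₑ := by
  have hnorm : LocallyIntegrable (fun t => ‖deriv γ t‖) :=
    fun t => (hlip.locallyIntegrable_deriv t).norm
  have hInt (x y : ℝ) : IntervalIntegrable (fun t => ‖deriv γ t‖) volume x y :=
    (hlip.intervalIntegrable_deriv_s13 x y).norm
  set S : ℝ → ℝ := fun x => ∫ t in 0..x, ‖deriv γ t‖ with hS
  have hsub (x y : ℝ) : S x - S y = ∫ t in y..x, ‖deriv γ t‖ :=
    intervalIntegral.integral_interval_sub_left (hInt 0 x) (hInt 0 y)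
  have hSlip : LipschitzWith K S := by
    refine LipschitzWith.of_dist_le_mul fun x y => ?_
    rw [dist_eq_norm, hsub, Real.dist_eq]
    exact intervalIntegral.norm_integral_le_of_norm_le_const
      fun t _ => by simpa using norm_deriv_le_of_lipschitz hlip
  have hdist (x y : ℝ) : dist (γ x) (γ y) ≤ dist (S x) (S y) := by
    rw [dist_eq_norm, dist_eq_norm, hsub, ← hlip.integral_deriv_eq_sub,
      Real.norm_eq_abs]
    exact intervalIntegral.norm_integral_le_abs_integral_norm
  have hfactor : μH[1] (γ '' s) ≤ volume (S '' s) := by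
    have hinv : ∀ y ∈ S '' s, S (Function.invFunOn S s y) = y :=
      fun y hy => Function.invFunOn_eq hy
    have hL : LipschitzOnWith 1 (γ ∘ Function.invFunOn S s) (S '' s) := by
      refine LipschitzOnWith.of_dist_le_mul fun x hx y hy => ?_
      have := hdist (Function.invFunOn S s x) (Function.invFunOn S s y)
      rw [hinv x hx, hinv y hy] at this
      simpa using this
    have himage : γ '' s ⊆ (γ ∘ Function.invFunOn S s) '' (S '' s) := by
      rintro _ ⟨t, ht, rfl⟩
      refine ⟨S t, mem_image_of_mem S ht, ?_⟩
      have h := hdist (Function.invFunOn S s (S t)) t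
      rw [hinv _ (mem_image_of_mem S ht), dist_self] at h
      exact dist_le_zero.1 h
    calc μH[1] (γ '' s) ≤ μH[1] ((γ ∘ Function.invFunOn S s) '' (S '' s)) := measure_mono himage
      _ ≤ μH[1] (S '' s) := by simpa using hL.hausdorffMeasure_image_le zero_le_one
      _ = volume (S '' s) := by rw [hausdorffMeasure_real]
  refine hfactor.trans ?_
  have hae := _root_.LocallyIntegrable.ae_hasDerivAt_integral hnorm
  set N := toMeasurable volume {x | ¬ ∀ c, HasDerivAt (fun x => ∫ t in c..x, ‖deriv γ t‖)
    ‖deriv γ x‖ x} with hN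
  have hN0 : volume N = 0 := by rw [hN, measure_toMeasurable]; exact hae
  have hderiv : ∀ x ∈ s \ N, HasFDerivWithinAt S
      (ContinuousLinearMap.toSpanSingleton ℝ ‖deriv γ x‖) (s \ N) x := by
    rintro x ⟨-, hx⟩
    have : ∀ c, HasDerivAt (fun x => ∫ t in c..x, ‖deriv γ t‖) ‖deriv γ x‖ x := by
      by_contra h
      exact hx (subset_toMeasurable _ _ h)
    exact (this 0).hasFDerivAt.hasFDerivWithinAt
  calc volume (S '' s) ≤ volume (S '' (s \ N)) + volume (S '' N) := by
        refine (measure_mono ?_).trans (measure_union_le _ _)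
        rw [← image_union, sdiff_union_self]
        exact image_mono subset_union_left
    _ ≤ (∫⁻ t in s \ N, ‖deriv γ t‖ₑ) + 0 := by
        refine add_le_add ?_ ?_
        · refine (addHaar_image_le_lintegral_abs_det_fderiv volume
            (hs.diff (measurableSet_toMeasurable _ _)) hderiv).trans_eq ?_
          simp [ContinuousLinearMap.det, hN]
        · have := hSlip.hausdorffMeasure_image_le zero_le_one N
          rw [hausdorffMeasure_real, hN0, mul_zero] at this
          exact this
    _ ≤ ∫⁻ t in s, ‖deriv γ t‖ₑ := by
        rw [add_zero]
        exact lintegral_mono_set sdiff_subset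

end LipschitzWith

section UniformPartition

/-- The `k`-th point of the partition of `[a, b]` into `n` intervals of equal length. -/
noncomputable def partitionPoint (a b : ℝ) (n k : ℕ) : ℝ := a + k * ((b - a) / n)

/-- The index of the interval containing `t` in the partition of `[a, b)` into `n` half-open
intervals of equal length. -/
noncomputable def partitionIndex (a b : ℝ) (n : ℕ) (t : ℝ) : ℕ := ⌊(t - a) / ((b - a) / n)⌋₊

variable {a b : ℝ} {n k : ℕ} {t : ℝ}

@[simp]
theorem partitionPoint_zero : partitionPoint a b n 0 = a := by simp [partitionPoint]

theorem partitionPoint_self (hn : n ≠ 0) : partitionPoint a b n n = b := by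
  simp only [partitionPoint]
  field_simp
  ring

theorem partitionPoint_succ_sub :
    partitionPoint a b n (k + 1) - partitionPoint a b n k = (b - a) / n := by
  simp only [partitionPoint]
  push_cast
  ring

theorem monotone_partitionPoint (hab : a < b) (n : ℕ) : Monotone (partitionPoint a b n) := by
  intro k l hkl
  have : 0 ≤ (b - a) / n := div_nonneg (sub_nonneg.2 hab.le) n.cast_nonneg
  simp only [partitionPoint]
  gcongr

theorem partitionPoint_lt_succ (hab : a < b) (hn : n ≠ 0) :
    partitionPoint a b n k < partitionPoint a b n (k + 1) := by
  have : 0 < (b - a) / n := div_pos (sub_pos.2 hab) (by positivity)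
  linarith [partitionPoint_succ_sub (a := a) (b := b) (n := n) (k := k)]

theorem mem_Ico_partitionPoint_iff (hab : a < b) (hn : n ≠ 0) (ht : t ∈ Ico a b) :
    t ∈ Ico (partitionPoint a b n k) (partitionPoint a b n (k + 1)) ↔
      partitionIndex a b n t = k := by
  have hδ : 0 < (b - a) / n := div_pos (sub_pos.2 hab) (by positivity)
  rw [partitionIndex, Nat.floor_eq_iff (div_nonneg (sub_nonneg.2 ht.1) hδ.le), le_div_iff₀ hδ,
    div_lt_iff₀ hδ, mem_Ico, partitionPoint, partitionPoint]
  push_cast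
  constructor <;> rintro ⟨h₁, h₂⟩ <;> constructor <;> linarith

theorem partitionIndex_lt (hab : a < b) (hn : n ≠ 0) (ht : t ∈ Ico a b) :
    partitionIndex a b n t < n := by
  have hδ : 0 < (b - a) / n := div_pos (sub_pos.2 hab) (by positivity)
  rw [partitionIndex, Nat.floor_lt (div_nonneg (sub_nonneg.2 ht.1) hδ.le), div_lt_iff₀ hδ]
  field_simp
  linarith [ht.2]

theorem mem_Ico_partitionIndex (hab : a < b) (hn : n ≠ 0) (ht : t ∈ Ico a b) :
    t ∈ Ico (partitionPoint a b n (partitionIndex a b n t))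
      (partitionPoint a b n (partitionIndex a b n t + 1)) :=
  (mem_Ico_partitionPoint_iff hab hn ht).2 rfl

theorem Ico_partitionPoint_subset (hab : a < b) (hk : k < n) :
    Ico (partitionPoint a b n k) (partitionPoint a b n (k + 1)) ⊆ Ico a b := by
  have hmono := monotone_partitionPoint hab n
  refine Ico_subset_Ico ?_ ?_
  · simpa using hmono k.zero_le
  · simpa [partitionPoint_self (Nat.ne_zero_of_lt hk)] using hmono (Nat.succ_le_of_lt hk)

theorem biUnion_Ico_partitionPoint (hab : a < b) (hn : n ≠ 0) :
    ⋃ k ∈ Finset.range n, Ico (partitionPoint a b n k) (partitionPoint a b n (k + 1)) =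
      Ico a b := by
  refine subset_antisymm
    (iUnion₂_subset fun k hk => Ico_partitionPoint_subset hab (Finset.mem_range.1 hk)) ?_
  exact fun t ht => mem_iUnion₂.2 ⟨_, Finset.mem_range.2 (partitionIndex_lt hab hn ht),
    mem_Ico_partitionIndex hab hn ht⟩

theorem pairwiseDisjoint_Ico_partitionPoint (hab : a < b) (s : Set ℕ) :
    s.PairwiseDisjoint
      fun k => Ico (partitionPoint a b n k) (partitionPoint a b n (k + 1)) :=
  (monotone_partitionPoint hab n).pairwise_disjoint_on_Ico_succ.set_pairwise s

theorem tendsto_partition_mesh (a b : ℝ) :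
    Tendsto (fun n : ℕ => (b - a) / n) atTop (𝓝 0) :=
  tendsto_const_div_atTop_nhds_zero_nat _

theorem abs_sub_lt_of_partitionIndex_eq (hab : a < b) (hn : n ≠ 0) {s : ℝ} (hs : s ∈ Ico a b)
    (ht : t ∈ Ico a b) (h : partitionIndex a b n s = partitionIndex a b n t) :
    |s - t| < (b - a) / n := by
  have h₁ := mem_Ico_partitionIndex hab hn hs
  have h₂ := mem_Ico_partitionIndex hab hn ht
  rw [h] at h₁
  have h₃ := partitionPoint_succ_sub (a := a) (b := b) (n := n) (k := partitionIndex a b n t)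
  rw [abs_lt]
  constructor <;> linarith [h₁.1, h₁.2, h₂.1, h₂.2]

theorem eventually_partitionIndex_injOn (hab : a < b) (F : Finset ℝ) (hF : ↑F ⊆ Ico a b) :
    ∀ᶠ n in atTop, InjOn (partitionIndex a b n) F := by
  have h : ∀ s ∈ F, ∀ t ∈ F, ∀ᶠ n in atTop,
      partitionIndex a b n s = partitionIndex a b n t → s = t := by
    intro s hs t ht
    by_cases hst : s = t
    · simp [hst]
    filter_upwards [eventually_ne_atTop 0,
      (tendsto_partition_mesh a b).eventually_lt_const (abs_pos.2 (sub_ne_zero.2 hst))]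
      with n hn hlt heq
    exact absurd (abs_sub_lt_of_partitionIndex_eq hab hn (hF hs) (hF ht) heq) hlt.not_gt
  filter_upwards [(Filter.eventually_all_finset F).2 fun s hs =>
    (Filter.eventually_all_finset F).2 (h s hs)] with n hn s hs t ht
  exact hn s hs t ht

/-- The slope of the chord of `γ` over the interval of the partition containing `t`. -/
noncomputable def partitionSlope (γ : ℝ → ℂ) (a b : ℝ) (n : ℕ) (t : ℝ) : ℂ :=
  slope γ (partitionPoint a b n (partitionIndex a b n t))
    (partitionPoint a b n (partitionIndex a b n t + 1))

theorem measurable_partitionIndex : Measurable (partitionIndex a b n) :=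
  Nat.measurable_floor.comp ((measurable_id.sub_const a).div_const _)

theorem measurable_partitionSlope (γ : ℝ → ℂ) : Measurable (partitionSlope γ a b n) :=
  (measurable_from_nat (f := fun k => slope γ (partitionPoint a b n k)
    (partitionPoint a b n (k + 1)))).comp measurable_partitionIndex

theorem partitionSlope_of_mem (γ : ℝ → ℂ) (hab : a < b) (hk : k < n)
    (ht : t ∈ Ico (partitionPoint a b n k) (partitionPoint a b n (k + 1))) :
    partitionSlope γ a b n t =
      slope γ (partitionPoint a b n k) (partitionPoint a b n (k + 1)) := by
  rw [partitionSlope, (mem_Ico_partitionPoint_iff hab (Nat.ne_zero_of_lt hk)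
    (Ico_partitionPoint_subset hab hk ht)).1 ht]

theorem tendsto_partitionSlope {γ : ℝ → ℂ} (hab : a < b) (ht : t ∈ Ico a b)
    (hγ : DifferentiableAt ℝ γ t) :
    Tendsto (fun n => partitionSlope γ a b n t) atTop (𝓝 (deriv γ t)) := by
  rw [Metric.tendsto_atTop']
  intro ε hε
  have hlo := hγ.hasDerivAt.isLittleO.def (half_pos hε)
  obtain ⟨δ, hδ, hball⟩ := Metric.eventually_nhds_iff.1 hlo
  obtain ⟨N, hN⟩ := eventually_atTop.1
    ((tendsto_partition_mesh a b).eventually_lt_const hδ)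
  refine ⟨N, fun n hn => ?_⟩
  have hn0 : n ≠ 0 := Nat.ne_zero_of_lt hn
  have hmesh := hN n hn.le
  have hmem := mem_Ico_partitionIndex hab hn0 ht
  have hlen := partitionPoint_succ_sub (a := a) (b := b) (n := n) (k := partitionIndex a b n t)
  rw [partitionSlope]
  set p := partitionPoint a b n (partitionIndex a b n t)
  set q := partitionPoint a b n (partitionIndex a b n t + 1)
  have hpq : p < q := partitionPoint_lt_succ hab hn0
  have hp := hball (y := p) (by
    rw [Real.dist_eq, abs_lt]; constructor <;> linarith [hmem.1, hmem.2])
  have hq := hball (y := q) (by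
    rw [Real.dist_eq, abs_lt]; constructor <;> linarith [hmem.1, hmem.2])
  rw [Real.norm_eq_abs, abs_of_nonpos (by linarith [hmem.1])] at hp
  rw [Real.norm_eq_abs, abs_of_nonneg (by linarith [hmem.2])] at hq
  have hq0 : 0 < q - p := sub_pos.2 hpq
  have key : slope γ p q - deriv γ t = (q - p)⁻¹ • ((γ q - γ t - (q - t) • deriv γ t) -
      (γ p - γ t - (p - t) • deriv γ t)) := by
    have : (q - p)⁻¹ • ((q - p) • deriv γ t) = deriv γ t := inv_smul_smul₀ hq0.ne' _
    nth_rw 1 [← this]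
    rw [slope_def_module, ← smul_sub]
    congr 1
    module
  rw [dist_eq_norm, key, norm_smul, norm_inv, Real.norm_of_nonneg hq0.le, inv_mul_lt_iff₀ hq0]
  refine (norm_sub_le _ _).trans_lt ((add_le_add hq hp).trans_lt ?_)
  nlinarith

end UniformPartition

section AreaFormula

/-- The number of parameters in `s` at which `γ` takes the value `x`. -/
noncomputable def curveMultiplicity (γ : ℝ → ℂ) (s : Set ℝ) (x : ℂ) : ℝ≥0∞ :=
  ((γ ⁻¹' {x} ∩ s).encard : ℝ≥0∞)

/-- The number of intervals of the uniform partition of `[a, b)` whose image contains `x`. -/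
noncomputable def partitionMultiplicity (γ : ℝ → ℂ) (a b : ℝ) (n : ℕ) (x : ℂ) : ℝ≥0∞ :=
  ∑ k ∈ Finset.range n,
    (γ '' Ico (partitionPoint a b n k) (partitionPoint a b n (k + 1))).indicator 1 x

variable {γ : ℝ → ℂ} {K : ℝ≥0} {a b : ℝ} {n : ℕ}

theorem Continuous.measurableSet_image_Ico (hγ : Continuous γ) (c d : ℝ) :
    MeasurableSet (γ '' Ico c d) := by
  rcases le_or_gt c d with h | h
  · rw [← measurableSet_insert (a := γ d), ← image_insert_eq, Ico_insert_right h]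
    exact (isCompact_Icc.image hγ).measurableSet
  · simp [Ico_eq_empty_of_le h.le]

theorem measurable_partitionMultiplicity (hγ : Continuous γ) :
    Measurable (partitionMultiplicity γ a b n) :=
  Finset.measurable_fun_sum _ fun _ _ =>
    measurable_one.indicator (hγ.measurableSet_image_Ico _ _)

open Classical in
theorem partitionMultiplicity_eq_card (x : ℂ) :
    partitionMultiplicity γ a b n x = ({k ∈ Finset.range n |
      x ∈ γ '' Ico (partitionPoint a b n k) (partitionPoint a b n (k + 1))}.card : ℝ≥0∞) := by
  simp [partitionMultiplicity, indicator_apply]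

theorem partitionMultiplicity_le (hab : a < b) (hn : n ≠ 0) (x : ℂ) :
    partitionMultiplicity γ a b n x ≤ curveMultiplicity γ (Ico a b) x := by
  classical
  rw [partitionMultiplicity_eq_card, curveMultiplicity]
  set T := {k ∈ Finset.range n |
    x ∈ γ '' Ico (partitionPoint a b n k) (partitionPoint a b n (k + 1))}
  have hT : ∀ k ∈ T, ∃ t, γ t = x ∧ t ∈ Ico a b ∧ partitionIndex a b n t = k := by
    intro k hk
    obtain ⟨hkn, t, ht, rfl⟩ := Finset.mem_filter.1 hk
    have htI := Ico_partitionPoint_subset hab (Finset.mem_range.1 hkn) ht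
    exact ⟨t, rfl, htI, (mem_Ico_partitionPoint_iff hab hn htI).1 ht⟩
  choose! f hf using hT
  have hinj : InjOn f T := by
    intro k hk l hl hkl
    rw [← (hf k hk).2.2, ← (hf l hl).2.2, hkl]
  have hsub : f '' T ⊆ γ ⁻¹' {x} ∩ Ico a b := by
    rintro _ ⟨k, hk, rfl⟩
    exact ⟨(hf k hk).1, (hf k hk).2.1⟩
  have h := encard_le_encard hsub
  rw [hinj.encard_image, encard_coe_eq_coe_finsetCard] at h
  exact_mod_cast h

theorem le_liminf_partitionMultiplicity (hab : a < b) (x : ℂ) :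
    curveMultiplicity γ (Ico a b) x ≤
      liminf (fun n => partitionMultiplicity γ a b n x) atTop := by
  classical
  have hF (F : Finset ℝ) (hF : ↑F ⊆ γ ⁻¹' {x} ∩ Ico a b) :
      (F.card : ℝ≥0∞) ≤ liminf (fun n => partitionMultiplicity γ a b n x) atTop := by
    refine le_liminf_of_le (by isBoundedDefault) ?_
    filter_upwards [eventually_ne_atTop 0, eventually_partitionIndex_injOn hab F
      (hF.trans inter_subset_right)] with n hn hinj
    rw [partitionMultiplicity_eq_card]
    refine Nat.cast_le.2 (Finset.card_le_card_of_injOn _ (fun t ht => ?_) hinj)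
    have htI := (hF ht).2
    exact Finset.mem_filter.2 ⟨Finset.mem_range.2 (partitionIndex_lt hab hn htI), t,
      mem_Ico_partitionIndex hab hn htI, (hF ht).1⟩
  rw [curveMultiplicity]
  rcases (γ ⁻¹' {x} ∩ Ico a b).finite_or_infinite with hfin | hinf
  · have h := hF hfin.toFinset (by simp)
    rwa [hfin.encard_eq_coe_toFinset_card, ENat.toENNReal_coe]
  · refine le_of_le_of_eq le_top (ENNReal.eq_top_of_forall_nnreal_le fun r => ?_).symm
    obtain ⟨m, hm⟩ := exists_nat_ge r
    obtain ⟨F, hFsub, hcard⟩ := hinf.exists_subset_card_eq m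
    refine le_trans ?_ (hF F hFsub)
    rw [hcard]
    exact_mod_cast hm

theorem liminf_partitionMultiplicity (hab : a < b) (x : ℂ) :
    liminf (fun n => partitionMultiplicity γ a b n x) atTop =
      curveMultiplicity γ (Ico a b) x := by
  refine le_antisymm ?_ (le_liminf_partitionMultiplicity hab x)
  refine (liminf_le_liminf ?_).trans_eq (liminf_const (f := (atTop : Filter ℕ)) _)
  filter_upwards [eventually_ne_atTop 0] with n hn
  exact partitionMultiplicity_le hab hn x

theorem measurable_curveMultiplicity (hγ : Continuous γ) (hab : a < b) :
    Measurable (curveMultiplicity γ (Ico a b)) := by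
  rw [show curveMultiplicity γ (Ico a b) = fun x => liminf (partitionMultiplicity γ a b · x) atTop
    from funext fun x => (liminf_partitionMultiplicity hab x).symm]
  exact Measurable.liminf fun n => measurable_partitionMultiplicity hγ

theorem edist_le_hausdorffMeasure_image_Ico (hγ : Continuous γ) {c d : ℝ} (hcd : c ≤ d) :
    edist (γ c) (γ d) ≤ μH[1] (γ '' Ico c d) := by
  have hL : LipschitzWith 1 fun z : ℂ => dist z (γ c) := LipschitzWith.dist_left _
  have h := hL.hausdorffMeasure_image_le zero_le_one (γ '' Ico c d)
  rw [image_image, hausdorffMeasure_real, ENNReal.coe_one, ENNReal.one_rpow, one_mul] at h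
  refine le_trans ?_ h
  have hivt := intermediate_value_Ico hcd (f := fun t => dist (γ t) (γ c))
    (by fun_prop : Continuous fun t => dist (γ t) (γ c)).continuousOn
  refine le_trans ?_ (measure_mono hivt)
  rw [Real.volume_Ico, dist_self, sub_zero, edist_dist, dist_comm]

theorem setLIntegral_curveMultiplicity_le (hlip : LipschitzWith K γ) (hab : a < b) {s : Set ℂ}
    (hs : MeasurableSet s) :
    ∫⁻ x in s, curveMultiplicity γ (Ico a b) x ∂μH[1] ≤
      ∫⁻ t in Ico a b ∩ γ ⁻¹' s, ‖deriv γ t‖ₑ := by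
  have hpre : MeasurableSet (γ ⁻¹' s) := hlip.continuous.measurable hs
  simp_rw [← liminf_partitionMultiplicity hab]
  refine (lintegral_liminf_le fun n => measurable_partitionMultiplicity hlip.continuous).trans ?_
  refine (liminf_le_liminf ?_).trans_eq (liminf_const (f := (atTop : Filter ℕ)) _)
  filter_upwards [eventually_ne_atTop 0] with n hn
  simp only [partitionMultiplicity]
  rw [lintegral_finsetSum _ fun k _ =>
    measurable_one.indicator (hlip.continuous.measurableSet_image_Ico _ _)]
  rw [← biUnion_Ico_partitionPoint hab hn, iUnion₂_inter, lintegral_biUnion_finset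
    (fun i hi j hj hij => (pairwiseDisjoint_Ico_partitionPoint hab (univ) trivial trivial hij).mono
      inter_subset_left inter_subset_left) fun k _ => measurableSet_Ico.inter hpre]
  refine Finset.sum_le_sum fun k _ => ?_
  rw [lintegral_indicator_one (hlip.continuous.measurableSet_image_Ico _ _),
    Measure.restrict_apply (hlip.continuous.measurableSet_image_Ico _ _), ← image_inter_preimage]
  exact hlip.hausdorffMeasure_image_le_lintegral_deriv (measurableSet_Ico.inter hpre)

theorem lintegral_deriv_le_lintegral_curveMultiplicity (hlip : LipschitzWith K γ) (hab : a < b) :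
    ∫⁻ t in Ico a b, ‖deriv γ t‖ₑ ≤ ∫⁻ x, curveMultiplicity γ (Ico a b) x ∂μH[1] := by
  have hlim : ∀ᵐ t ∂volume.restrict (Ico a b),
      ‖deriv γ t‖ₑ = liminf (fun n => ‖partitionSlope γ a b n t‖ₑ) atTop := by
    filter_upwards [ae_restrict_of_ae hlip.ae_differentiableAt_real,
      ae_restrict_mem measurableSet_Ico] with t ht hmem
    exact ((tendsto_partitionSlope hab hmem ht).enorm.liminf_eq).symm
  rw [lintegral_congr_ae hlim]
  refine (lintegral_liminf_le fun n => (measurable_partitionSlope γ).enorm).trans ?_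
  refine (liminf_le_liminf ?_).trans_eq (liminf_const (f := (atTop : Filter ℕ)) _)
  filter_upwards [eventually_ne_atTop 0] with n hn
  rw [← biUnion_Ico_partitionPoint hab hn, lintegral_biUnion_finset
    (pairwiseDisjoint_Ico_partitionPoint hab _) fun k _ => measurableSet_Ico,
    biUnion_Ico_partitionPoint hab hn]
  refine le_trans ?_ (lintegral_mono fun x => partitionMultiplicity_le hab hn x)
  simp only [partitionMultiplicity]
  rw [lintegral_finsetSum _ fun k _ =>
    measurable_one.indicator (hlip.continuous.measurableSet_image_Ico _ _)]
  refine Finset.sum_le_sum fun k hk => ?_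
  rw [lintegral_indicator_one (hlip.continuous.measurableSet_image_Ico _ _)]
  have hlt : partitionPoint a b n k < partitionPoint a b n (k + 1) := partitionPoint_lt_succ hab hn
  refine le_trans (le_of_eq ?_) (edist_le_hausdorffMeasure_image_Ico hlip.continuous hlt.le)
  rw [setLIntegral_congr_fun measurableSet_Ico fun t ht => by
    rw [partitionSlope_of_mem γ hab (Finset.mem_range.1 hk) ht], setLIntegral_const,
    Real.volume_Ico, slope_def_module, enorm_smul, edist_comm, edist_eq_enorm_sub, mul_right_comm,
    ← Real.enorm_of_nonneg (sub_nonneg.2 hlt.le), ← enorm_mul, inv_mul_cancel₀ (sub_pos.2 hlt).ne']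
  simp

/-- The area formula for a Lipschitz curve, as an equality of measures on the plane. -/
theorem withDensity_curveMultiplicity (hlip : LipschitzWith K γ) (hab : a < b) :
    (μH[1] : Measure ℂ).withDensity (curveMultiplicity γ (Ico a b)) =
      ((volume.restrict (Ico a b)).withDensity fun t => ‖deriv γ t‖ₑ).map γ := by
  have hfin : IsFiniteMeasure ((volume.restrict (Ico a b)).withDensity fun t => ‖deriv γ t‖ₑ) :=
    isFiniteMeasure_withDensity (hlip.integrable_deriv_restrict_Ico a b).2.ne
  have happly {s : Set ℂ} (hs : MeasurableSet s) :
      ((volume.restrict (Ico a b)).withDensity fun t => ‖deriv γ t‖ₑ).map γ s =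
        ∫⁻ t in Ico a b ∩ γ ⁻¹' s, ‖deriv γ t‖ₑ := by
    have hpre : MeasurableSet (γ ⁻¹' s) := hlip.continuous.measurable hs
    rw [Measure.map_apply hlip.continuous.measurable hs, withDensity_apply _ hpre,
      Measure.restrict_restrict hpre, inter_comm]
  have hle : (μH[1] : Measure ℂ).withDensity (curveMultiplicity γ (Ico a b)) ≤
      ((volume.restrict (Ico a b)).withDensity fun t => ‖deriv γ t‖ₑ).map γ :=
    Measure.le_iff.2 fun s hs => by
      rw [happly hs, withDensity_apply _ hs]
      exact setLIntegral_curveMultiplicity_le hlip hab hs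
  have : IsFiniteMeasure ((μH[1] : Measure ℂ).withDensity (curveMultiplicity γ (Ico a b))) :=
    isFiniteMeasure_of_le _ hle
  refine Measure.eq_of_le_of_measure_univ_eq hle (le_antisymm (hle _) ?_)
  rw [happly .univ, withDensity_apply _ .univ, preimage_univ, inter_univ, Measure.restrict_univ]
  exact lintegral_deriv_le_lintegral_curveMultiplicity hlip hab

/-- The total multiplicity of a Lipschitz curve equals its length. -/
theorem lintegral_curveMultiplicity (hlip : LipschitzWith K γ) (hab : a < b) :
    ∫⁻ x, curveMultiplicity γ (Ico a b) x ∂μH[1] = ∫⁻ t in Ico a b, ‖deriv γ t‖ₑ := by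
  have h := congrArg (fun μ => μ univ) (withDensity_curveMultiplicity hlip hab)
  simpa [Measure.map_apply hlip.continuous.measurable] using h

theorem lintegral_curveMultiplicity_ne_top (hlip : LipschitzWith K γ) (hab : a < b) :
    ∫⁻ x, curveMultiplicity γ (Ico a b) x ∂μH[1] ≠ ∞ := by
  rw [lintegral_curveMultiplicity hlip hab]
  exact (hlip.integrable_deriv_restrict_Ico a b).2.ne

end AreaFormula

section Transversality

/-- A curve has only countably many transversal double points. -/
theorem countable_transversal_pairs (γ : ℝ → ℂ) :
    {p : ℝ × ℝ | γ p.1 = γ p.2 ∧ LinearIndependent ℝ ![deriv γ p.1, deriv γ p.2]}.Countable := by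
  have hdisc : IsDiscrete
      {p : ℝ × ℝ | γ p.1 = γ p.2 ∧ LinearIndependent ℝ ![deriv γ p.1, deriv γ p.2]} := by
    rw [isDiscrete_iff_nhdsNE]
    rintro ⟨s, t⟩ ⟨-, hind⟩
    have hs : DifferentiableAt ℝ γ s :=
      differentiableAt_of_deriv_ne_zero (by simpa using hind.ne_zero 0)
    have ht : DifferentiableAt ℝ γ t :=
      differentiableAt_of_deriv_ne_zero (by simpa using hind.ne_zero 1)
    have hd : HasFDerivAt (fun p : ℝ × ℝ => γ p.1 - γ p.2) _ (s, t) :=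
      (hs.hasDerivAt.hasFDerivAt.comp (s, t) hasFDerivAt_fst).sub
        (ht.hasDerivAt.hasFDerivAt.comp (s, t) hasFDerivAt_snd)
    have hne := hd.eventually_ne (c := 0) (by
      refine (LinearMap.exists_antilipschitzWith (ContinuousLinearMap.toLinearMap _)
        (LinearMap.ker_eq_bot'.2 ?_)).imp fun _ h => h.2
      rintro ⟨u, v⟩ huv
      have huv' : u • deriv γ s + (-v) • deriv γ t = 0 := by
        simpa [sub_eq_add_neg] using huv
      obtain ⟨h₁, h₂⟩ := LinearIndependent.pair_iff.1 hind u (-v) huv'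
      simp [h₁, neg_eq_zero.1 h₂])
    rw [← disjoint_iff, disjoint_principal_right]
    filter_upwards [hne] with p hp hmem
    exact hp (sub_eq_zero.2 hmem.1)
  exact (HereditarilyLindelofSpace.isLindelof _).countable_of_isDiscrete hdisc

theorem countable_transversal_points (γ : ℝ → ℂ) :
    {x | ∃ s t, γ s = x ∧ γ t = x ∧ LinearIndependent ℝ ![deriv γ s, deriv γ t]}.Countable := by
  refine ((countable_transversal_pairs γ).image fun p => γ p.1).mono ?_
  rintro _ ⟨s, t, rfl, hst, hind⟩
  exact ⟨(s, t), ⟨hst.symm, hind⟩, rfl⟩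

/-- If nonzero vectors on a common line have normalizations summing to zero, then their number
is even. -/
theorem even_card_of_sum_normalized_eq_zero {ι E : Type*} [NormedAddCommGroup E] [NormedSpace ℝ E]
    {F : Finset ι} {v : ι → E} (hv : ∀ i ∈ F, v i ≠ 0)
    (hpar : ∀ i ∈ F, ∀ j ∈ F, ¬ LinearIndependent ℝ ![v i, v j])
    (hsum : ∑ i ∈ F, ‖v i‖⁻¹ • v i = 0) : Even F.card := by
  rcases F.eq_empty_or_nonempty with rfl | ⟨i₀, hi₀⟩
  · simp
  have hr : ∀ i ∈ F, ∃ r : ℝ, r • v i₀ = v i := fun i hi => by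
    simpa [LinearIndependent.pair_iff' (hv i₀ hi₀)] using hpar i₀ hi₀ i hi
  choose! r hr using hr
  have hr0 : ∀ i ∈ F, r i ≠ 0 := by
    rintro i hi h
    exact hv i hi (by rw [← hr i hi, h, zero_smul])
  have hsign : ∀ i ∈ F, ‖v i‖⁻¹ • v i =
      ((SignType.sign (r i) : ℤ) : ℝ) • ‖v i₀‖⁻¹ • v i₀ := by
    intro i hi
    rw [← hr i hi, norm_smul, mul_inv, smul_smul, smul_smul]
    congr 1
    rcases (hr0 i hi).lt_or_gt with h | h
    · rw [sign_neg h, Real.norm_of_nonpos h.le]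
      have := h.ne
      simp
      field_simp
    · rw [sign_pos h, Real.norm_of_nonneg h.le]
      have := h.ne'
      simp
      field_simp
  rw [Finset.sum_congr rfl hsign, ← Finset.sum_smul, smul_eq_zero] at hsum
  have hzero : ∑ i ∈ F, (SignType.sign (r i) : ℤ) = 0 := by
    rcases hsum with h | h
    · exact_mod_cast h
    · exact absurd h (smul_ne_zero (inv_ne_zero (norm_ne_zero_iff.2 (hv i₀ hi₀))) (hv i₀ hi₀))
  rw [← ZMod.natCast_eq_zero_iff_even]
  have hcast := congrArg (Int.cast : ℤ → ZMod 2) hzero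
  rw [Int.cast_sum, Int.cast_zero, Finset.sum_congr rfl (g := fun _ => (1 : ZMod 2))] at hcast
  · simpa using hcast
  · intro i hi
    rcases (hr0 i hi).lt_or_gt with h | h
    · rw [sign_neg h]
      decide
    · rw [sign_pos h]
      decide

end Transversality

section CauchyPompeiu

/-- Twice the Cauchy–Riemann derivative `∂φ/∂z̄` of a real-valued function. -/
noncomputable def cauchyRiemann (φ : ℂ → ℝ) (w : ℂ) : ℂ :=
  fderiv ℝ φ w 1 + Complex.I * fderiv ℝ φ w Complex.I

variable {φ : ℂ → ℝ}

theorem continuous_cauchyRiemann (hφ : ContDiff ℝ 1 φ) : Continuous (cauchyRiemann φ) := by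
  have h := hφ.continuous_fderiv one_ne_zero
  unfold cauchyRiemann
  fun_prop

theorem HasCompactSupport.cauchyRiemann (hs : HasCompactSupport φ) :
    HasCompactSupport (cauchyRiemann φ) := by
  refine (hs.fderiv ℝ).mono fun w hw => ?_
  contrapose! hw
  rw [Function.notMem_support] at hw ⊢
  simp [_root_.cauchyRiemann, hw]

theorem integrable_indicator_ball_norm_inv :
    Integrable ((Metric.ball (0 : ℂ) 1).indicator fun v => ‖v‖⁻¹) := by
  have h := (integrable_fun_norm_addHaar (volume : Measure ℂ)
    (f := (Iio (1 : ℝ)).indicator fun y => y⁻¹)).2 ?_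
  · refine h.congr (.of_forall fun v => ?_)
    by_cases h1 : ‖v‖ < 1 <;> simp [indicator, h1]
  · simp only [Complex.finrank_real_complex]
    have hbase : IntegrableOn (indicator (Ioo (0 : ℝ) 1) fun _ => (1 : ℝ)) (Ioi 0) :=
      ((integrable_indicator_iff measurableSet_Ioo).2 (by simp)).integrableOn
    refine hbase.congr_fun (fun y hy => ?_) measurableSet_Ioi
    have hy' : y ≠ 0 := (mem_Ioi.1 hy).ne'
    have hy0 : 0 < y := hy
    by_cases h1 : y < 1 <;> simp [h1, hy', hy0]

theorem integral_norm_div_norm_sub_le {g : ℂ → ℂ} (hg : Continuous g) (hs : HasCompactSupport g) :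
    ∃ C, ∀ z, Integrable (fun w => g w / (w - z)) ∧ ∫ w, ‖g w / (w - z)‖ ≤ C := by
  obtain ⟨M, hM⟩ := hg.bounded_above_of_compact_support hs
  have hInt : Integrable g := hg.integrable_of_hasCompactSupport hs
  set k : ℂ → ℝ := (Metric.ball (0 : ℂ) 1).indicator fun v => ‖v‖⁻¹ with hk
  have hdom (z : ℂ) : Integrable fun w => ‖g w‖ + M * k (w - z) :=
    hInt.norm.add ((integrable_indicator_ball_norm_inv.comp_sub_right z).const_mul M)
  have hle (z w : ℂ) : ‖g w / (w - z)‖ ≤ ‖g w‖ + M * k (w - z) := by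
    rw [norm_div, div_eq_mul_inv]
    have hM0 : 0 ≤ M := (norm_nonneg _).trans (hM w)
    by_cases h : ‖w - z‖ < 1
    · rw [hk, indicator_of_mem (by simpa using h)]
      have := mul_le_mul_of_nonneg_right (hM w) (inv_nonneg.2 (norm_nonneg (w - z)))
      linarith [norm_nonneg (g w)]
    · rw [hk, indicator_of_notMem (by simpa using h), mul_zero, add_zero]
      exact mul_le_of_le_one_right (norm_nonneg _) (inv_le_one_of_one_le₀ (not_lt.1 h))
  refine ⟨(∫ w, ‖g w‖) + M * ∫ w, k w, fun z => ?_⟩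
  have hI : Integrable (fun w => g w / (w - z)) :=
    (hdom z).mono' (by fun_prop : Measurable fun w => g w / (w - z)).aestronglyMeasurable
      (.of_forall (hle z))
  refine ⟨hI, (integral_mono hI.norm (hdom z) (hle z)).trans_eq ?_⟩
  rw [integral_add hInt.norm ((integrable_indicator_ball_norm_inv.comp_sub_right z).const_mul M),
    integral_const_mul, integral_sub_right_eq_self]

/-- The Cauchy–Pompeiu formula for compactly supported functions. -/
theorem integral_cauchyRiemann_div_sub (hφ : ContDiff ℝ 1 φ) (hs : HasCompactSupport φ) (z : ℂ) :
    ∫ w, cauchyRiemann φ w / (w - z) = -(2 * Real.pi * φ z) := by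
  have hshift : ∫ w, cauchyRiemann φ w / (w - z) = ∫ v, cauchyRiemann φ (z + v) / v := by
    rw [← integral_add_left_eq_self _ z]
    simp
  rw [hshift, ← Complex.integral_comp_polarCoord_symm]
  set e : ℝ → ℂ := fun θ => Real.cos θ + Real.sin θ * Complex.I with he
  have hde (θ : ℝ) : HasDerivAt e (Complex.I * e θ) θ := by
    have h₁ := (Real.hasDerivAt_cos θ).ofReal_comp
    have h₂ := ((Real.hasDerivAt_sin θ).ofReal_comp).mul_const Complex.I
    refine (h₁.add h₂).congr_deriv ?_
    simp only [he]
    push_cast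
    linear_combination (-Complex.sin θ) * Complex.I_sq
  have hnorm (θ : ℝ) : ‖e θ‖ = 1 := by
    simp [he, ← Complex.exp_mul_I, Complex.norm_exp_ofReal_mul_I]
  have hec : Continuous e := continuous_iff_continuousAt.2 fun θ => (hde θ).continuousAt
  set A : ℝ × ℝ → ℝ := fun p => fderiv ℝ φ (z + p.1 * e p.2) (e p.2) with hA
  set B : ℝ × ℝ → ℝ := fun p => fderiv ℝ φ (z + p.1 * e p.2) (Complex.I * e p.2) with hB
  have hfd := hφ.continuous_fderiv one_ne_zero
  have hAc : Continuous A := by fun_prop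
  have hBc : Continuous B := by fun_prop
  have hpolar : ∀ p ∈ polarCoord.target, p.1 • (cauchyRiemann φ (z + Complex.polarCoord.symm p) /
      Complex.polarCoord.symm p) = (A p : ℂ) + Complex.I * (B p : ℂ) := by
    rintro ⟨r, θ⟩ ⟨hr, -⟩
    have hr' : (r : ℂ) ≠ 0 := Complex.ofReal_ne_zero.2 (mem_Ioi.1 hr).ne'
    have he0 : e θ ≠ 0 := norm_ne_zero_iff.1 (by simp [hnorm])
    have h₁ : e θ = Real.cos θ • (1 : ℂ) + Real.sin θ • Complex.I := by
      simp [he]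
    have h₂ : Complex.I * e θ = (-Real.sin θ) • (1 : ℂ) + Real.cos θ • Complex.I := by
      simp only [he, Complex.real_smul]
      push_cast
      linear_combination Complex.sin θ * Complex.I_sq
    have hsymm : Complex.polarCoord.symm (r, θ) = r * e θ := by
      rw [Complex.polarCoord_symm_apply]
    have hA' : A (r, θ) = Real.cos θ * fderiv ℝ φ (z + r * e θ) 1 +
        Real.sin θ * fderiv ℝ φ (z + r * e θ) Complex.I := by
      simp only [hA]
      nth_rw 2 [h₁]
      simp only [map_add, map_smul, smul_eq_mul]
    have hB' : B (r, θ) = -Real.sin θ * fderiv ℝ φ (z + r * e θ) 1 +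
        Real.cos θ * fderiv ℝ φ (z + r * e θ) Complex.I := by
      simp only [hB]
      rw [h₂]
      simp only [map_add, map_smul, smul_eq_mul]
    have hsq : (Real.sin θ : ℂ) ^ 2 + (Real.cos θ : ℂ) ^ 2 = 1 := by
      exact_mod_cast Real.sin_sq_add_cos_sq θ
    rw [hA', hB', hsymm, cauchyRiemann, Complex.real_smul]
    generalize fderiv ℝ φ (z + r * e θ) 1 = x
    generalize fderiv ℝ φ (z + r * e θ) Complex.I = y
    rw [← mul_div_assoc, mul_div_mul_left _ _ hr', div_eq_iff he0]
    simp only [he]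
    push_cast at hsq ⊢
    linear_combination (-(x + Complex.I * y)) * hsq +
      (Complex.sin θ * x * Complex.sin θ - y * Complex.sin θ * Complex.cos θ) * Complex.I_sq
  obtain ⟨R, hR⟩ : ∃ R, ∀ r θ, R < r → φ =ᶠ[𝓝 (z + (r : ℝ) * e θ)] 0 := by
    obtain ⟨ρ, hρ⟩ := hs.isBounded.subset_closedBall (0 : ℂ)
    refine ⟨ρ + ‖z‖, fun r θ hr => notMem_tsupport_iff_eventuallyEq.1 fun hmem => ?_⟩
    have h₁ : ‖z + r * e θ‖ ≤ ρ := by simpa using hρ hmem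
    have h₂ : ‖(r : ℂ) * e θ‖ = |r| := by simp [hnorm]
    have h₃ := norm_sub_le (z + r * e θ) z
    rw [add_sub_cancel_left, h₂] at h₃
    linarith [le_abs_self r]
  have hAR (r θ : ℝ) (hr : R < r) : A (r, θ) = 0 := by
    simp [hA, (hR r θ hr).fderiv_eq]
  have hBR (r θ : ℝ) (hr : R < r) : B (r, θ) = 0 := by
    simp [hB, (hR r θ hr).fderiv_eq]
  have hInt {f : ℝ × ℝ → ℝ} (hf : Continuous f) (hf0 : ∀ r θ, R < r → f (r, θ) = 0) :
      IntegrableOn f (Ioi 0 ×ˢ Ioo (-Real.pi) Real.pi) (volume.prod volume) := by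
    have hcpt : IntegrableOn f (Icc 0 R ×ˢ Icc (-Real.pi) Real.pi) (volume.prod volume) :=
      hf.continuousOn.integrableOn_compact (isCompact_Icc.prod isCompact_Icc)
    refine hcpt.of_forall_sdiff_eq_zero (measurableSet_Ioi.prod measurableSet_Ioo) ?_
    rintro ⟨r, θ⟩ ⟨⟨hr, hθ⟩, hnot⟩
    refine hf0 r θ (not_le.1 fun hle => hnot ⟨⟨le_of_lt hr, hle⟩, Ioo_subset_Icc_self hθ⟩)
  have hradial (θ : ℝ) : ∫ r in Ioi 0, A (r, θ) = - φ z := by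
    have hd (r : ℝ) : HasDerivAt (fun r : ℝ => φ (z + r * e θ)) (A (r, θ)) r := by
      have h := ((hφ.differentiable one_ne_zero (z + r * e θ)).hasFDerivAt).comp_hasDerivAt r
        (((Complex.ofRealCLM.hasDerivAt (x := r)).mul_const (e θ)).const_add z)
      simpa [hA, Function.comp_def] using h
    have hAi : IntegrableOn (fun r => A (r, θ)) (Ioi 0) := by
      have hcpt : IntegrableOn (fun r => A (r, θ)) (Icc 0 R) :=
        (by fun_prop : Continuous fun r => A (r, θ)).continuousOn.integrableOn_compact isCompact_Icc
      refine hcpt.of_forall_sdiff_eq_zero measurableSet_Ioi ?_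
      rintro r ⟨hr, hnot⟩
      exact hAR r θ (not_le.1 fun hle => hnot ⟨le_of_lt hr, hle⟩)
    rw [integral_Ioi_of_hasDerivAt_of_tendsto (hd 0).continuousAt.continuousWithinAt
      (fun r _ => hd r) hAi (m := 0)]
    · simp
    · refine tendsto_const_nhds.congr' ?_
      filter_upwards [eventually_gt_atTop R] with r hr
      exact (hR r θ hr).self_of_nhds.symm
  have hangular (r : ℝ) (hr : 0 < r) : ∫ θ in Ioo (-Real.pi) Real.pi, B (r, θ) = 0 := by
    have hd (θ : ℝ) : HasDerivAt (fun θ : ℝ => φ (z + r * e θ)) (r * B (r, θ)) θ := by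
      have h := ((hφ.differentiable one_ne_zero (z + r * e θ)).hasFDerivAt).comp_hasDerivAt θ
        (((hde θ).const_mul (r : ℂ)).const_add z)
      refine h.congr_deriv ?_
      rw [show (r : ℂ) * (Complex.I * e θ) = r • (Complex.I * e θ) from Complex.real_smul.symm,
        map_smul, smul_eq_mul]
    have h := intervalIntegral.integral_eq_sub_of_hasDerivAt (a := -Real.pi) (b := Real.pi)
      (fun θ _ => hd θ) ((by fun_prop : Continuous fun θ => r * B (r, θ)).intervalIntegrable _ _)
    rw [intervalIntegral.integral_const_mul] at h
    rw [← integral_Ioc_eq_integral_Ioo, ← intervalIntegral.integral_of_le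
      (by linarith [Real.pi_pos])]
    simpa [he, hr.ne'] using h
  have hAint : ∫ p in polarCoord.target, A p = - (2 * Real.pi * φ z) := by
    rw [polarCoord_target, Measure.volume_eq_prod, ← Measure.prod_restrict, integral_prod_symm _
      (by rw [Measure.prod_restrict]; exact hInt hAc hAR)]
    simp only [hradial]
    simp [Real.pi_pos.le, ← two_mul]
  have hBint : ∫ p in polarCoord.target, B p = 0 := by
    rw [polarCoord_target, Measure.volume_eq_prod, setIntegral_prod _ (hInt hBc hBR)]
    exact setIntegral_eq_zero_of_forall_eq_zero hangular
  rw [setIntegral_congr_fun polarCoord.open_target.measurableSet hpolar, integral_add,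
    integral_const_mul, integral_complex_ofReal, integral_complex_ofReal, hAint, hBint]
  · simp
  · exact (hInt hAc hAR).ofReal
  · exact (hInt hBc hBR).ofReal.const_mul _

end CauchyPompeiu

section VanishingIntegral

variable {γ : ℝ → ℂ} {K : ℝ≥0} {φ : ℂ → ℝ}

theorem LipschitzWith.volume_range_eq_zero (hlip : LipschitzWith K γ) :
    volume (range γ) = 0 := by
  have h2 : (μH[2] : Measure ℂ) (range γ) = 0 := by
    rw [← image_univ]
    refine le_antisymm ((hlip.lipschitzOnWith (s := univ)).hausdorffMeasure_image_le
      zero_le_two |>.trans_eq ?_) zero_le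
    rw [Real.hausdorffMeasure_of_finrank_lt (E := ℝ) (by norm_num)]
    simp
  have hac : (volume : Measure ℂ) ≪ μH[2] := by
    have h := Measure.absolutelyContinuous_isAddHaarMeasure (volume : Measure ℂ)
      (μH[Module.finrank ℝ ℂ])
    rw [Complex.finrank_real_complex] at h
    exact_mod_cast h
  exact hac h2

/-- If a closed Lipschitz curve has vanishing winding number off its image, the vector-valued
measure `γ' dt` pushed forward by `γ` vanishes. -/
theorem integral_smul_deriv_eq_zero_of_winding_eq_zero (hlip : LipschitzWith K γ)
    (hw : ∀ x ∉ range γ, winding γ x = 0) (hφ : ContDiff ℝ 1 φ) (hs : HasCompactSupport φ) :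
    ∫ t in Ico (0 : ℝ) 1, φ (γ t) • deriv γ t = 0 := by
  obtain ⟨C, hC⟩ := integral_norm_div_norm_sub_le (continuous_cauchyRiemann hφ) hs.cauchyRiemann
  have hcR := continuous_cauchyRiemann hφ
  have hγ := hlip.continuous
  have hγ' := measurable_deriv γ
  set F : ℝ → ℂ → ℂ := fun t w => cauchyRiemann φ w / (w - γ t) * deriv γ t with hF
  have hInt : Integrable (Function.uncurry F) ((volume.restrict (Ico 0 1)).prod volume) := by
    have hm : Measurable (Function.uncurry F) := by
      simp only [hF, Function.uncurry_def]
      fun_prop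
    refine (integrable_prod_iff hm.aestronglyMeasurable).2 ⟨.of_forall fun t =>
      (hC (γ t)).1.mul_const (deriv γ t), ?_⟩
    refine (integrable_const (C * K)).mono'
      hm.norm.stronglyMeasurable.integral_prod_right'.aestronglyMeasurable (.of_forall fun t => ?_)
    simp only [Function.uncurry_apply_pair, hF, norm_mul, integral_mul_const, norm_norm]
    rw [Real.norm_of_nonneg (by positivity)]
    exact mul_le_mul (hC (γ t)).2 (norm_deriv_le_of_lipschitz hlip) (norm_nonneg _)
      ((integral_nonneg fun _ => norm_nonneg _).trans (hC (γ t)).2)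
  have hswap := integral_integral_swap hInt
  have hleft (t : ℝ) : ∫ w, F t w = -(2 * Real.pi) * (φ (γ t) • deriv γ t) := by
    rw [integral_mul_const, integral_cauchyRiemann_div_sub hφ hs, Complex.real_smul]
    ring
  have hright : ∀ᵐ w : ℂ, ∫ t in Ico (0 : ℝ) 1, F t w = 0 := by
    filter_upwards [measure_eq_zero_iff_ae_notMem.1 hlip.volume_range_eq_zero] with w hwr
    have h0 := hw w hwr
    rw [winding, mul_eq_zero, or_iff_right (inv_ne_zero Complex.two_pi_I_ne_zero),
      intervalIntegral.integral_of_le zero_le_one, ← integral_Ico_eq_integral_Ioc] at h0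
    have hFw (t : ℝ) : F t w = -cauchyRiemann φ w * (deriv γ t / (γ t - w)) := by
      simp only [hF]
      rw [← neg_sub (γ t) w, div_neg]
      ring
    simp only [hFw, integral_const_mul, h0, mul_zero]
  simp only [hleft] at hswap
  rw [integral_congr_ae hright, integral_zero, integral_const_mul] at hswap
  simpa [Real.pi_ne_zero] using hswap

end VanishingIntegral

section TangentSum

/-- The sum of the unit tangents of `γ` over the parameters in `s` at which `γ` takes the
value `x`. -/
noncomputable def tangentSum (γ : ℝ → ℂ) (s : Set ℝ) (x : ℂ) : ℂ :=
  ∑ᶠ t ∈ γ ⁻¹' {x} ∩ s, NormedSpace.normalize (deriv γ t)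

/-- The sum of the directions of the chords of `γ` over the intervals of the uniform partition of
`[a, b)`, weighted by the multiplicity with which they contain parameters at which `γ` takes the
value `x`. -/
noncomputable def partitionTangentSum (γ : ℝ → ℂ) (a b : ℝ) (n : ℕ) (x : ℂ) : ℂ :=
  ∑ k ∈ Finset.range n,
    (curveMultiplicity γ (Ico (partitionPoint a b n k) (partitionPoint a b n (k + 1))) x).toReal •
      NormedSpace.normalize (slope γ (partitionPoint a b n k) (partitionPoint a b n (k + 1)))

variable {γ : ℝ → ℂ} {K : ℝ≥0} {a b : ℝ} {n : ℕ} {x : ℂ}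

theorem norm_normalize_le_one (z : ℂ) : ‖NormedSpace.normalize z‖ ≤ 1 := by
  rcases eq_or_ne z 0 with rfl | h
  · simp
  · exact (NormedSpace.norm_normalize h).le

theorem measurable_normalize : Measurable (NormedSpace.normalize : ℂ → ℂ) := by
  unfold NormedSpace.normalize
  fun_prop

theorem toReal_curveMultiplicity (hfin : (γ ⁻¹' {x} ∩ Ico a b).Finite) :
    (curveMultiplicity γ (Ico a b) x).toReal = hfin.toFinset.card := by
  rw [curveMultiplicity, hfin.encard_eq_coe_toFinset_card, ENat.toENNReal_coe,
    ENNReal.toReal_natCast]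

theorem partitionTangentSum_eq_sum (hab : a < b) (hn : n ≠ 0)
    (hfin : (γ ⁻¹' {x} ∩ Ico a b).Finite) :
    partitionTangentSum γ a b n x =
      ∑ t ∈ hfin.toFinset, NormedSpace.normalize (partitionSlope γ a b n t) := by
  classical
  rw [← Finset.sum_fiberwise_of_maps_to (t := Finset.range n) (g := partitionIndex a b n)
    fun t ht => Finset.mem_range.2 (partitionIndex_lt hab hn (hfin.mem_toFinset.1 ht).2)]
  refine Finset.sum_congr rfl fun k hk => ?_
  have hkn := Finset.mem_range.1 hk
  have hsub := Ico_partitionPoint_subset hab hkn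
  have hfink := hfin.subset (inter_subset_inter_right (γ ⁻¹' {x}) hsub)
  have heq : hfink.toFinset = {t ∈ hfin.toFinset | partitionIndex a b n t = k} := by
    ext t
    simp only [Finite.mem_toFinset, Finset.mem_filter, mem_inter_iff]
    constructor
    · rintro ⟨h₁, h₂⟩
      exact ⟨⟨h₁, hsub h₂⟩, (mem_Ico_partitionPoint_iff hab hn (hsub h₂)).1 h₂⟩
    · rintro ⟨⟨h₁, h₂⟩, h₃⟩
      exact ⟨h₁, (mem_Ico_partitionPoint_iff hab hn h₂).2 h₃⟩
  rw [toReal_curveMultiplicity hfink, heq, Nat.cast_smul_eq_nsmul]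
  refine (Finset.sum_eq_card_nsmul fun t ht => ?_).symm
  obtain ⟨ht, rfl⟩ := Finset.mem_filter.1 ht
  rfl

theorem norm_partitionTangentSum_le (hab : a < b) (hfin : (γ ⁻¹' {x} ∩ Ico a b).Finite) :
    ‖partitionTangentSum γ a b n x‖ ≤ (curveMultiplicity γ (Ico a b) x).toReal := by
  rcases eq_or_ne n 0 with rfl | hn
  · simp [partitionTangentSum]
  · rw [partitionTangentSum_eq_sum hab hn hfin, toReal_curveMultiplicity hfin]
    simpa using norm_sum_le_of_le hfin.toFinset fun t _ =>
      norm_normalize_le_one (partitionSlope γ a b n t)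

theorem tendsto_normalize_partitionSlope {t : ℝ} (hab : a < b) (ht : t ∈ Ico a b)
    (h0 : deriv γ t ≠ 0) :
    Tendsto (fun n => NormedSpace.normalize (partitionSlope γ a b n t)) atTop
      (𝓝 (NormedSpace.normalize (deriv γ t))) := by
  have h := tendsto_partitionSlope hab ht (differentiableAt_of_deriv_ne_zero h0)
  exact (h.norm.inv₀ (norm_ne_zero_iff.2 h0)).smul h

theorem tangentSum_eq_sum (hfin : (γ ⁻¹' {x} ∩ Ico a b).Finite) :
    tangentSum γ (Ico a b) x = ∑ t ∈ hfin.toFinset, NormedSpace.normalize (deriv γ t) :=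
  finsum_mem_eq_finite_toFinset_sum _ hfin

theorem tendsto_partitionTangentSum (hab : a < b) (hfin : (γ ⁻¹' {x} ∩ Ico a b).Finite)
    (h0 : ∀ t, γ t = x → deriv γ t ≠ 0) :
    Tendsto (fun n => partitionTangentSum γ a b n x) atTop (𝓝 (tangentSum γ (Ico a b) x)) := by
  rw [tangentSum_eq_sum hfin]
  refine (tendsto_finsetSum _ fun t ht => tendsto_normalize_partitionSlope hab
    (hfin.mem_toFinset.1 ht).2 (h0 t (hfin.mem_toFinset.1 ht).1)).congr' ?_
  filter_upwards [eventually_ne_atTop 0] with n hn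
  exact (partitionTangentSum_eq_sum hab hn hfin).symm

theorem measurable_partitionTangentSum (hγ : Continuous γ) (hab : a < b) :
    Measurable (partitionTangentSum γ a b n) := by
  rcases eq_or_ne n 0 with rfl | hn
  · rw [show partitionTangentSum γ a b 0 = 0 from funext fun _ => by simp [partitionTangentSum]]
    exact measurable_zero
  · exact Finset.measurable_fun_sum _ fun k _ =>
      (measurable_curveMultiplicity hγ (partitionPoint_lt_succ hab hn)).ennreal_toReal.smul_const _

theorem LipschitzWith.ae_finite_preimage (hlip : LipschitzWith K γ) (hab : a < b) :
    ∀ᵐ x ∂(μH[1] : Measure ℂ), (γ ⁻¹' {x} ∩ Ico a b).Finite := by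
  filter_upwards [ae_lt_top (measurable_curveMultiplicity hlip.continuous hab)
    (lintegral_curveMultiplicity_ne_top hlip hab)] with x hx
  simpa [curveMultiplicity, encard_lt_top_iff] using hx

theorem LipschitzWith.ae_deriv_ne_zero (hlip : LipschitzWith K γ) :
    ∀ᵐ x ∂(μH[1] : Measure ℂ), ∀ t, γ t = x → deriv γ t ≠ 0 := by
  have hm : MeasurableSet {t | deriv γ t = 0} := measurable_deriv γ (measurableSet_singleton 0)
  have h0 : (μH[1] : Measure ℂ) (γ '' {t | deriv γ t = 0}) = 0 := by
    refine le_antisymm ((hlip.hausdorffMeasure_image_le_lintegral_deriv hm).trans_eq ?_) zero_le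
    rw [setLIntegral_congr_fun (g := 0) hm fun t (ht : deriv γ t = 0) => by simp [ht]]
    simp
  filter_upwards [measure_eq_zero_iff_ae_notMem.1 h0] with x hx t ht h
  exact hx ⟨t, h, ht⟩

theorem integrable_toReal_curveMultiplicity (hlip : LipschitzWith K γ) (hab : a < b) :
    Integrable (fun x => (curveMultiplicity γ (Ico a b) x).toReal) μH[1] :=
  integrable_toReal_of_lintegral_ne_top
    (measurable_curveMultiplicity hlip.continuous hab).aemeasurable
    (lintegral_curveMultiplicity_ne_top hlip hab)

theorem integral_toReal_curveMultiplicity_smul (hlip : LipschitzWith K γ) (hab : a < b) {f : ℂ → ℂ}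
    (hf : Continuous f) :
    ∫ x, (curveMultiplicity γ (Ico a b) x).toReal • f x ∂μH[1] =
      ∫ t in Ico a b, ‖deriv γ t‖ • f (γ t) := by
  have hm := measurable_curveMultiplicity hlip.continuous hab
  rw [← integral_withDensity_eq_integral_toReal_smul hm
    (ae_lt_top hm (lintegral_curveMultiplicity_ne_top hlip hab)),
    withDensity_curveMultiplicity hlip hab,
    integral_map hlip.continuous.measurable.aemeasurable hf.aestronglyMeasurable,
    integral_withDensity_eq_integral_toReal_smul (measurable_deriv γ).enorm (by simp)]
  simp

theorem integral_smul_partitionTangentSum (hlip : LipschitzWith K γ) (hab : a < b) (hn : n ≠ 0)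
    {f : ℂ → ℝ} (hf : Continuous f) (hs : HasCompactSupport f) :
    ∫ x, f x • partitionTangentSum γ a b n x ∂μH[1] =
      ∫ t in Ico a b, f (γ t) • ‖deriv γ t‖ • NormedSpace.normalize (partitionSlope γ a b n t) := by
  obtain ⟨M, hM⟩ := hf.bounded_above_of_compact_support hs
  have hInt : IntegrableOn
      (fun t => f (γ t) • ‖deriv γ t‖ • NormedSpace.normalize (partitionSlope γ a b n t))
      (Ico a b) := by
    have hm := measurable_normalize.comp (measurable_partitionSlope (a := a) (b := b) (n := n) γ)
    exact ((hlip.integrable_deriv_restrict_Ico a b).norm.smul_bdd 1 hm.aestronglyMeasurable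
      (.of_forall fun t => norm_normalize_le_one _)).bdd_smul M
      (hf.comp hlip.continuous).aestronglyMeasurable (.of_forall fun t => hM (γ t))
  rw [← biUnion_Ico_partitionPoint hab hn, integral_biUnion_finset _
    (fun _ _ => measurableSet_Ico) (pairwiseDisjoint_Ico_partitionPoint hab _)
    fun k hk => hInt.mono_set (Ico_partitionPoint_subset hab (Finset.mem_range.1 hk))]
  simp only [partitionTangentSum, Finset.smul_sum]
  rw [integral_finsetSum]
  · refine Finset.sum_congr rfl fun k hk => ?_
    set u := NormedSpace.normalize (slope γ (partitionPoint a b n k) (partitionPoint a b n (k + 1)))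
    have h := integral_toReal_curveMultiplicity_smul hlip
      (partitionPoint_lt_succ hab hn (k := k)) (f := fun x => f x • u) (by fun_prop)
    simp only [smul_comm (f _)]
    rw [h]
    refine setIntegral_congr_fun measurableSet_Ico fun t ht => ?_
    simp only [partitionSlope_of_mem γ hab (Finset.mem_range.1 hk) ht, u]
  · intro k _
    exact Integrable.bdd_smul (𝕜 := ℝ) ((integrable_toReal_curveMultiplicity hlip
      (partitionPoint_lt_succ hab hn)).smul_const _) M hf.aestronglyMeasurable (.of_forall hM)

theorem aestronglyMeasurable_tangentSum (hlip : LipschitzWith K γ) (hab : a < b) :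
    AEStronglyMeasurable (tangentSum γ (Ico a b)) μH[1] := by
  refine aestronglyMeasurable_of_tendsto_ae atTop (fun n =>
    (measurable_partitionTangentSum (n := n) hlip.continuous hab).aestronglyMeasurable) ?_
  filter_upwards [hlip.ae_finite_preimage hab, hlip.ae_deriv_ne_zero] with x hx h0
  exact tendsto_partitionTangentSum hab hx h0

theorem integrable_tangentSum (hlip : LipschitzWith K γ) (hab : a < b) :
    Integrable (tangentSum γ (Ico a b)) μH[1] := by
  refine (integrable_toReal_curveMultiplicity hlip hab).mono'
    (aestronglyMeasurable_tangentSum hlip hab) ?_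
  filter_upwards [hlip.ae_finite_preimage hab] with x hx
  rw [tangentSum_eq_sum hx, toReal_curveMultiplicity hx]
  simpa using norm_sum_le_of_le hx.toFinset fun t _ => norm_normalize_le_one (deriv γ t)

/-- The vector-valued area formula: pushing forward `γ' dt` along `γ` gives the sum of the unit
tangents times the Hausdorff measure. -/
theorem integral_smul_tangentSum (hlip : LipschitzWith K γ) (hab : a < b)
    {f : ℂ → ℝ} (hf : Continuous f) (hs : HasCompactSupport f) :
    ∫ x, f x • tangentSum γ (Ico a b) x ∂μH[1] = ∫ t in Ico a b, f (γ t) • deriv γ t := by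
  obtain ⟨M, hM⟩ := hf.bounded_above_of_compact_support hs
  have hM0 : 0 ≤ M := (norm_nonneg _).trans (hM 0)
  have hleft : Tendsto (fun n => ∫ x, f x • partitionTangentSum γ a b n x ∂μH[1]) atTop
      (𝓝 (∫ x, f x • tangentSum γ (Ico a b) x ∂μH[1])) := by
    refine tendsto_integral_of_dominated_convergence
      (fun x => M * (curveMultiplicity γ (Ico a b) x).toReal)
      (fun n => hf.aestronglyMeasurable.smul
        (measurable_partitionTangentSum hlip.continuous hab).aestronglyMeasurable)
      ((integrable_toReal_curveMultiplicity hlip hab).const_mul M) (fun n => ?_) ?_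
    · filter_upwards [hlip.ae_finite_preimage hab] with x hx
      rw [norm_smul]
      exact mul_le_mul (hM x) (norm_partitionTangentSum_le hab hx) (norm_nonneg _) hM0
    · filter_upwards [hlip.ae_finite_preimage hab, hlip.ae_deriv_ne_zero] with x hx h0
      exact (tendsto_partitionTangentSum hab hx h0).const_smul _
  have hright : Tendsto (fun n => ∫ t in Ico a b,
      f (γ t) • ‖deriv γ t‖ • NormedSpace.normalize (partitionSlope γ a b n t)) atTop
      (𝓝 (∫ t in Ico a b, f (γ t) • deriv γ t)) := by
    refine tendsto_integral_of_dominated_convergence (fun t => M * ‖deriv γ t‖) (fun n => ?_)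
      ((hlip.integrable_deriv_restrict_Ico a b).norm.const_mul M) (fun n => ?_) ?_
    · exact (hf.comp hlip.continuous).aestronglyMeasurable.smul
        ((measurable_deriv γ).norm.smul
          (measurable_normalize.comp (measurable_partitionSlope γ))).aestronglyMeasurable
    · refine .of_forall fun t => ?_
      rw [norm_smul, norm_smul, norm_norm]
      exact mul_le_mul (hM _) (mul_le_of_le_one_right (norm_nonneg _) (norm_normalize_le_one _))
        (by positivity) hM0
    · filter_upwards [ae_restrict_mem measurableSet_Ico] with t ht
      refine Tendsto.const_smul ?_ _
      rcases eq_or_ne (deriv γ t) 0 with h0 | h0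
      · simp [h0]
      · conv_rhs => rw [← NormedSpace.norm_smul_normalize (deriv γ t)]
        exact (tendsto_normalize_partitionSlope hab ht h0).const_smul _
  refine tendsto_nhds_unique (hleft.congr' ?_) hright
  filter_upwards [eventually_ne_atTop 0] with n hn
  exact integral_smul_partitionTangentSum hlip hab hn hf hs

theorem ae_tangentSum_eq_zero (hlip : LipschitzWith K γ)
    (hw : ∀ x ∉ range γ, winding γ x = 0) :
    ∀ᵐ x ∂(μH[1] : Measure ℂ), tangentSum γ (Ico 0 1) x = 0 := by
  refine ae_eq_zero_of_integral_contDiff_smul_eq_zero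
    (integrable_tangentSum hlip zero_lt_one).locallyIntegrable fun f hf hs => ?_
  rw [integral_smul_tangentSum hlip zero_lt_one hf.continuous hs]
  exact integral_smul_deriv_eq_zero_of_winding_eq_zero hlip hw (hf.of_le (by simp)) hs

theorem ae_even_ncard_preimage (hlip : LipschitzWith K γ)
    (hw : ∀ x ∉ range γ, winding γ x = 0) :
    ∀ᵐ x ∂(μH[1] : Measure ℂ), Even (γ ⁻¹' {x} ∩ Ico 0 1).ncard := by
  have : NullSingletonClass (μH[1] : Measure ℂ) :=
    Measure.nullSingletonClass_hausdorff ℂ zero_lt_one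
  have htrans := (countable_transversal_points γ).measure_zero (μH[1] : Measure ℂ)
  filter_upwards [hlip.ae_finite_preimage zero_lt_one, hlip.ae_deriv_ne_zero,
    ae_tangentSum_eq_zero hlip hw, measure_eq_zero_iff_ae_notMem.1 htrans] with x hx h0 hsum hpar
  rw [tangentSum_eq_sum hx] at hsum
  rw [ncard_eq_toFinset_card _ hx]
  have hmem {t : ℝ} (ht : t ∈ hx.toFinset) : γ t = x := (hx.mem_toFinset.1 ht).1
  exact even_card_of_sum_normalized_eq_zero (v := deriv γ) (fun t ht => h0 t (hmem ht))
    (fun s hs t ht hind => hpar ⟨s, t, hmem hs, hmem ht, hind⟩) hsum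

end TangentSum

section ClosedCurve

variable {γ : ℝ → ℂ} {K : ℝ≥0}

theorem Function.Periodic.range_eq_image_Ico (hper : Function.Periodic γ 1) :
    range γ = γ '' Ico 0 1 := by
  refine subset_antisymm ?_ (image_subset_range _ _)
  rintro _ ⟨t, rfl⟩
  obtain ⟨s, hs, hst⟩ := hper.exists_mem_Ico₀ zero_lt_one t
  exact ⟨s, hs, hst.symm⟩

theorem setLIntegral_range_ncard_preimage (hlip : LipschitzWith K γ) :
    ∫⁻ x in range γ, ((γ ⁻¹' {x} ∩ Ico (0 : ℝ) 1).ncard : ℝ≥0∞) ∂μH[1] =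
      ENNReal.ofReal (∫ t in (0 : ℝ)..1, ‖deriv γ t‖) := by
  have hsupp : Function.support (curveMultiplicity γ (Ico 0 1)) ⊆ range γ := by
    intro x hx
    contrapose! hx
    have hempty : γ ⁻¹' {x} = ∅ := preimage_singleton_eq_empty.2 hx
    simp [curveMultiplicity, hempty]
  rw [intervalIntegral.integral_of_le zero_le_one, ← integral_Ico_eq_integral_Ioc,
    ofReal_integral_norm_eq_lintegral_enorm (hlip.integrable_deriv_restrict_Ico 0 1),
    ← lintegral_curveMultiplicity hlip zero_lt_one,
    ← setLIntegral_eq_of_support_subset hsupp]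
  refine lintegral_congr_ae (ae_restrict_of_ae ?_)
  filter_upwards [hlip.ae_finite_preimage zero_lt_one] with x hx
  rw [curveMultiplicity, ← hx.cast_ncard_eq, ENat.toENNReal_coe]

theorem ae_even_and_two_le_ncard_preimage (hper : Function.Periodic γ 1)
    (hlip : LipschitzWith K γ) (hw : ∀ x ∉ range γ, winding γ x = 0) :
    ∀ᵐ x ∂(μH[1] : Measure ℂ).restrict (range γ),
      Even (γ ⁻¹' {x} ∩ Ico (0 : ℝ) 1).ncard ∧ 2 ≤ (γ ⁻¹' {x} ∩ Ico (0 : ℝ) 1).ncard := by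
  rw [hper.range_eq_image_Ico]
  filter_upwards [ae_restrict_mem (hlip.continuous.measurableSet_image_Ico 0 1),
    ae_restrict_of_ae (hlip.ae_finite_preimage zero_lt_one),
    ae_restrict_of_ae (ae_even_ncard_preimage hlip hw)] with x hx hfin heven
  obtain ⟨t, ht, rfl⟩ := hx
  have hpos := (ncard_pos hfin).2 ⟨t, rfl, ht⟩
  exact ⟨heven, by grind⟩

end ClosedCurve

end

/-- for a Lipschitz closed curve with identically zero winding number off
its image, H¹-a.e. point of the image has an even number (hence ≥ 2) of preimages in a
fundamental domain; by the area formula the length ∫|γ'| equals ∫ #γ⁻¹(x) dH¹(x), and is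
therefore at least 2·H¹(image). -/
theorem stmt_13 (γ : ℝ → ℂ) (hper : Function.Periodic γ 1)
    (K : NNReal) (hlip : LipschitzWith K γ)
    (hw : ∀ x ∉ Set.range γ, winding γ x = 0) :
    (∀ᵐ x ∂(MeasureTheory.Measure.hausdorffMeasure 1 :
        MeasureTheory.Measure ℂ).restrict (Set.range γ),
      Even ((γ ⁻¹' {x} ∩ Ico (0:ℝ) 1).ncard) ∧ 2 ≤ (γ ⁻¹' {x} ∩ Ico (0:ℝ) 1).ncard) ∧
    ENNReal.ofReal (∫ t in (0:ℝ)..1, ‖deriv γ t‖) =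
      (∫⁻ x in Set.range γ, ((γ ⁻¹' {x} ∩ Ico (0:ℝ) 1).ncard : ENNReal)
        ∂(MeasureTheory.Measure.hausdorffMeasure 1 : MeasureTheory.Measure ℂ)) ∧
    2 * (MeasureTheory.Measure.hausdorffMeasure 1 : MeasureTheory.Measure ℂ)
        (Set.range γ) ≤ ENNReal.ofReal (∫ t in (0:ℝ)..1, ‖deriv γ t‖) := by
  have hae := ae_even_and_two_le_ncard_preimage hper hlip hw
  have hlen := setLIntegral_range_ncard_preimage hlip
  refine ⟨hae, hlen.symm, ?_⟩
  rw [← hlen, ← setLIntegral_const]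
  refine lintegral_mono_ae ?_
  filter_upwards [hae] with x hx
  exact_mod_cast hx.2
end

section
/- Let γ : ℝ/ℤ → ℝ² be a Lipschitz closed curve with ω(γ, x) = 0 for all x ∉ γ(ℝ/ℤ), and let α = α₁ dx₁ + α₂ dx₂ be a C¹ 1-form on ℝ². Then ∫₀¹ ⟨α(γ(t)), γ'(t)⟩ dt = ∫_{ℝ²} ω(γ, x) (∂α₂/∂x₁ − ∂α₁/∂x₂) dx = 0. -/
open MeasureTheory Set

/-- The image of a Lipschitz curve in the plane has zero area. -/
lemma volume_range_eq_zero_of_lipschitz {γ : ℝ → ℂ} {K : NNReal} (hlip : LipschitzWith K γ) :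
    volume (range γ) = 0 := by
  have hac : (volume : Measure ℂ) ≪ Measure.hausdorffMeasure (Module.finrank ℝ ℂ) :=
    Measure.absolutelyContinuous_isAddHaarMeasure _ _
  have hd : dimH (range γ) < ((2 : NNReal) : ENNReal) := by
    refine lt_of_le_of_lt hlip.dimH_range_le ?_
    rw [Real.dimH_univ]
    norm_num
  refine measure_zero_of_dimH_lt ?_ hd
  simpa using hac

/-- A continuous function on the polar plane which vanishes for large radii is integrable on the
target of the polar coordinates. -/
lemma integrableOn_polarCoord_target_of_continuous {G : ℝ × ℝ → ℂ} (hG : Continuous G) {R : ℝ}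
    (hR : ∀ p : ℝ × ℝ, R < p.1 → G p = 0) : IntegrableOn G polarCoord.target := by
  have h₁ : IntegrableOn G (Icc 0 R ×ˢ Icc (-Real.pi) Real.pi) :=
    hG.continuousOn.integrableOn_compact (isCompact_Icc.prod isCompact_Icc)
  refine h₁.of_forall_sdiff_eq_zero polarCoord.open_target.measurableSet ?_
  rintro ⟨r, θ⟩ ⟨h, h'⟩
  simp only [polarCoord_target, mem_prod, mem_Ioi, mem_Ioo] at h
  refine hR _ (lt_of_not_ge fun hr => h' ?_)
  exact ⟨⟨h.1.le, hr⟩, h.2.1.le, h.2.2.le⟩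

/-- Integral of the radial derivative along a ray. -/
lemma integral_fderiv_ray {h : ℂ → ℂ} (hh : ContDiff ℝ 1 h) (hc : HasCompactSupport h)
    {e : ℂ} (he : e ≠ 0) :
    ∫ r in Ioi (0 : ℝ), fderiv ℝ h (r * e) e = -h 0 := by
  have hd : ∀ r : ℝ, HasDerivAt (fun r : ℝ => h (r * e)) (fderiv ℝ h (r * e) e) r := by
    intro r
    have h₁ : HasDerivAt (fun r : ℝ => (r : ℂ) * e) e r := by
      simpa using (Complex.ofRealCLM.hasDerivAt (x := r)).mul_const e
    exact ((hh.differentiable one_ne_zero) _).hasFDerivAt.comp_hasDerivAt r h₁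
  have hsm : ContDiff ℝ 1 (fun r : ℝ => h (r * e)) :=
    hh.comp (Complex.ofRealCLM.contDiff.mul contDiff_const)
  have hcs : HasCompactSupport (fun r : ℝ => h (r * e)) := by
    obtain ⟨R, hR⟩ := hc.isCompact.isBounded.exists_norm_le
    refine HasCompactSupport.of_support_subset_isCompact
      (isCompact_Icc (a := -(R / ‖e‖)) (b := R / ‖e‖)) ?_
    intro r hr
    have h₁ := hR _ (subset_tsupport _ hr)
    rw [norm_mul, Complex.norm_real, ← le_div_iff₀ (norm_pos_iff.2 he)] at h₁
    exact abs_le.1 h₁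
  have := hcs.integral_Ioi_deriv_eq hsm 0
  simpa [fun r => (hd r).deriv] using this

/-- The integral of the angular derivative along a circle vanishes. -/
lemma integral_fderiv_circle {h : ℂ → ℂ} (hh : ContDiff ℝ 1 h) {r : ℝ} (hr : r ≠ 0) :
    ∫ θ in Ioo (-Real.pi) Real.pi,
      fderiv ℝ h (r * Complex.exp (θ * Complex.I)) (Complex.I * Complex.exp (θ * Complex.I))
      = 0 := by
  have hd : ∀ θ : ℝ, HasDerivAt (fun θ : ℝ => h (r * Complex.exp (θ * Complex.I)))
      (r • fderiv ℝ h (r * Complex.exp (θ * Complex.I))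
        (Complex.I * Complex.exp (θ * Complex.I))) θ := by
    intro θ
    have h₀ : HasDerivAt (fun θ : ℝ => (θ : ℂ) * Complex.I) Complex.I θ := by
      simpa using (Complex.ofRealCLM.hasDerivAt (x := θ)).mul_const Complex.I
    have h₁ : HasDerivAt (fun θ : ℝ => (r : ℂ) * Complex.exp (θ * Complex.I))
        (r • (Complex.I * Complex.exp (θ * Complex.I))) θ := by
      refine (h₀.cexp.const_mul (r : ℂ)).congr_deriv ?_
      rw [Complex.real_smul]
      ring
    have h₂ := ((hh.differentiable one_ne_zero) _).hasFDerivAt.comp_hasDerivAt θ h₁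
    rwa [map_smul] at h₂
  have hcont : Continuous fun θ : ℝ => r • fderiv ℝ h (r * Complex.exp (θ * Complex.I))
      (Complex.I * Complex.exp (θ * Complex.I)) :=
    (((hh.continuous_fderiv one_ne_zero).comp (by fun_prop)).clm_apply
      (by fun_prop)).const_smul r
  have h₁ := intervalIntegral.integral_eq_sub_of_hasDerivAt (fun θ _ => hd θ)
    (hcont.intervalIntegrable (-Real.pi) Real.pi)
  rw [intervalIntegral.integral_of_le (by linarith [Real.pi_pos]), integral_Ioc_eq_integral_Ioo,
    integral_smul] at h₁
  have h₂ : Complex.exp (-(Real.pi * Complex.I)) = -1 := by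
    rw [Complex.exp_neg, Complex.exp_pi_mul_I]
    norm_num
  simpa [hr, h₂] using h₁

/-- The Cauchy-Riemann operator in polar coordinates. -/
lemma cauchyRiemann_polar (L : ℂ →L[ℝ] ℂ) (θ : ℝ) :
    (L 1 + Complex.I * L Complex.I) / Complex.exp (θ * Complex.I) =
      L (Complex.exp (θ * Complex.I)) +
        Complex.I * L (Complex.I * Complex.exp (θ * Complex.I)) := by
  have he : Complex.exp (θ * Complex.I) = (Real.cos θ : ℂ) + (Real.sin θ : ℂ) * Complex.I := by
    rw [Complex.exp_mul_I, Complex.ofReal_cos, Complex.ofReal_sin]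
  have h₁ : L (Complex.exp (θ * Complex.I)) =
      (Real.cos θ : ℂ) * L 1 + (Real.sin θ : ℂ) * L Complex.I := by
    have : Complex.exp (θ * Complex.I) =
        Real.cos θ • (1 : ℂ) + Real.sin θ • Complex.I := by
      simp [he]
    rw [this, map_add, map_smul, map_smul, Complex.real_smul, Complex.real_smul]
  have h₂ : L (Complex.I * Complex.exp (θ * Complex.I)) =
      (Real.cos θ : ℂ) * L Complex.I - (Real.sin θ : ℂ) * L 1 := by
    have : Complex.I * Complex.exp (θ * Complex.I) =
        Real.cos θ • Complex.I - Real.sin θ • (1 : ℂ) := by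
      rw [he, Complex.real_smul, Complex.real_smul]
      linear_combination (Real.sin θ : ℂ) * Complex.I_mul_I
    rw [this, map_sub, map_smul, map_smul, Complex.real_smul, Complex.real_smul]
  rw [div_eq_iff (Complex.exp_ne_zero _), h₁, h₂, he]
  have h₃ : (Real.cos θ : ℂ) ^ 2 + (Real.sin θ : ℂ) ^ 2 = 1 := by
    exact_mod_cast Real.cos_sq_add_sin_sq θ
  linear_combination (-(L 1) - Complex.I * L Complex.I) * h₃ +
    (-((Real.sin θ : ℂ) * Real.cos θ * L Complex.I) + (Real.sin θ : ℂ) ^ 2 * L 1) *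
      Complex.I_mul_I

/-- The Cauchy-Pompeiu formula at the origin. -/
lemma integral_cauchyRiemann_div_self {h : ℂ → ℂ} (hh : ContDiff ℝ 1 h)
    (hc : HasCompactSupport h) :
    ∫ w : ℂ, (fderiv ℝ h w 1 + Complex.I * fderiv ℝ h w Complex.I) / w =
      -(2 * Real.pi) * h 0 := by
  have hf : Continuous (fderiv ℝ h) := hh.continuous_fderiv one_ne_zero
  obtain ⟨R, hR⟩ := (hc.fderiv (𝕜 := ℝ)).isCompact.isBounded.exists_norm_le
  have hzero : ∀ p : ℝ × ℝ, R < p.1 →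
      fderiv ℝ h (p.1 * Complex.exp (p.2 * Complex.I)) = 0 := by
    intro p hp
    by_contra hne
    have := hR _ (subset_tsupport _ hne)
    rw [norm_mul, Complex.norm_exp_ofReal_mul_I, mul_one, Complex.norm_real] at this
    exact absurd ((le_abs_self _).trans this) (not_le.2 hp)
  have hi₁ : IntegrableOn (fun p : ℝ × ℝ => fderiv ℝ h (p.1 * Complex.exp (p.2 * Complex.I))
      (Complex.exp (p.2 * Complex.I))) polarCoord.target :=
    integrableOn_polarCoord_target_of_continuous (R := R)
      ((hf.comp (by fun_prop)).clm_apply (by fun_prop)) fun p hp => by simp [hzero p hp]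
  have hi₂ : IntegrableOn (fun p : ℝ × ℝ => fderiv ℝ h (p.1 * Complex.exp (p.2 * Complex.I))
      (Complex.I * Complex.exp (p.2 * Complex.I))) polarCoord.target :=
    integrableOn_polarCoord_target_of_continuous (R := R)
      ((hf.comp (by fun_prop)).clm_apply (by fun_prop)) fun p hp => by simp [hzero p hp]
  have hpolar : ∀ p ∈ polarCoord.target, p.1 •
      ((fderiv ℝ h (Complex.polarCoord.symm p) 1 +
        Complex.I * fderiv ℝ h (Complex.polarCoord.symm p) Complex.I) /
          Complex.polarCoord.symm p) =
      fderiv ℝ h (p.1 * Complex.exp (p.2 * Complex.I)) (Complex.exp (p.2 * Complex.I)) +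
        Complex.I * fderiv ℝ h (p.1 * Complex.exp (p.2 * Complex.I))
          (Complex.I * Complex.exp (p.2 * Complex.I)) := by
    intro p hp
    have hp1 : (p.1 : ℂ) ≠ 0 := by
      have : 0 < p.1 := hp.1
      exact_mod_cast this.ne'
    have hs : Complex.polarCoord.symm p = p.1 * Complex.exp (p.2 * Complex.I) := by
      rw [Complex.polarCoord_symm_apply, Complex.exp_mul_I, Complex.ofReal_cos,
        Complex.ofReal_sin]
    rw [← cauchyRiemann_polar, hs, Complex.real_smul]
    field_simp
  rw [← Complex.integral_comp_polarCoord_symm,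
    setIntegral_congr_fun polarCoord.open_target.measurableSet hpolar,
    integral_add hi₁ (hi₂.const_mul _), integral_const_mul]
  have h₁ : ∫ p in polarCoord.target, fderiv ℝ h (p.1 * Complex.exp (p.2 * Complex.I))
      (Complex.exp (p.2 * Complex.I)) = -(2 * Real.pi) * h 0 := by
    rw [polarCoord_target] at hi₁ ⊢
    rw [Measure.volume_eq_prod, ← Measure.prod_restrict, integral_prod_symm]
    · simp only [integral_fderiv_ray hh hc (Complex.exp_ne_zero _), setIntegral_const]
      rw [Measure.real, Real.volume_Ioo, ENNReal.toReal_ofReal (by linarith [Real.pi_pos]),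
        Complex.real_smul]
      push_cast
      ring
    · rw [Measure.prod_restrict]
      exact hi₁
  have h₂ : ∫ p in polarCoord.target, fderiv ℝ h (p.1 * Complex.exp (p.2 * Complex.I))
      (Complex.I * Complex.exp (p.2 * Complex.I)) = 0 := by
    rw [polarCoord_target] at hi₂ ⊢
    rw [Measure.volume_eq_prod, setIntegral_prod _ hi₂]
    refine setIntegral_eq_zero_of_forall_eq_zero fun r hr => ?_
    exact integral_fderiv_circle hh (ne_of_gt hr)
  rw [h₁, h₂, mul_zero, add_zero]

/-- The Cauchy-Pompeiu formula for compactly supported functions. -/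
lemma integral_cauchyRiemann_div_sub_s14 {h : ℂ → ℂ} (hh : ContDiff ℝ 1 h)
    (hc : HasCompactSupport h) (z : ℂ) :
    ∫ w : ℂ, (fderiv ℝ h w 1 + Complex.I * fderiv ℝ h w Complex.I) / (w - z) =
      -(2 * Real.pi) * h z := by
  have h₁ := integral_cauchyRiemann_div_self (h := fun w => h (w + z))
    (hh.comp (contDiff_id.add contDiff_const))
    (hc.comp_homeomorph (Homeomorph.addRight z))
  simp only [fderiv_comp_add_right, zero_add] at h₁
  rw [← h₁, ← integral_add_right_eq_self _ z]
  simp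

/-- The Cauchy kernel is locally integrable in the plane. -/
lemma locallyIntegrable_complex_inv : LocallyIntegrable (fun w : ℂ => w⁻¹) := by
  refine locallyIntegrable_of_norm_le_rpow (C := 1) (α := 1) (by simp) (by simp) ?_ ?_
  · exact Filter.Eventually.of_forall fun w => by simp [Real.rpow_neg_one]
  · exact measurable_inv.aestronglyMeasurable

/-- The Cauchy transform integrand along a Lipschitz curve is jointly integrable. -/
lemma integrable_deriv_mul_div_sub {γ : ℝ → ℂ} {K : NNReal} (hlip : LipschitzWith K γ)
    {k : ℂ → ℂ} (hk : Continuous k) (hc : HasCompactSupport k) :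
    Integrable (Function.uncurry fun (t : ℝ) (w : ℂ) => deriv γ t * (k w / (w - γ t)))
      ((volume.restrict (Ioc (0 : ℝ) 1)).prod volume) := by
  obtain ⟨M, hM⟩ := hk.bounded_above_of_compact_support hc
  obtain ⟨R, hR⟩ := hc.isCompact.isBounded.exists_norm_le
  obtain ⟨S, hS⟩ := (isCompact_Icc.image (s := Icc (0 : ℝ) 1)
    (hlip.continuous)).isBounded.exists_norm_le
  have hM0 : 0 ≤ M := (norm_nonneg _).trans (hM 0)
  have hker : Integrable (fun u : ℂ =>
      (Metric.closedBall (0 : ℂ) (R + S)).indicator (fun u => K * (M * ‖u⁻¹‖)) u) := by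
    rw [integrable_indicator_iff Metric.isClosed_closedBall.measurableSet]
    exact ((locallyIntegrable_complex_inv.integrableOn_isCompact
      (isCompact_closedBall _ _)).norm.const_mul M).const_mul K
  have hmeas : Measurable
      (Function.uncurry fun (t : ℝ) (w : ℂ) => deriv γ t * (k w / (w - γ t))) := by
    have hγ : Measurable γ := hlip.continuous.measurable
    exact ((measurable_deriv γ).comp measurable_fst).mul
      ((hk.measurable.comp measurable_snd).div
        (measurable_snd.sub (hγ.comp measurable_fst)))
  have hbound : ∀ t ∈ Ioc (0 : ℝ) 1, ∀ u : ℂ,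
      ‖deriv γ t * (k (u + γ t) / (u + γ t - γ t))‖ ≤
        (Metric.closedBall (0 : ℂ) (R + S)).indicator (fun u => K * (M * ‖u⁻¹‖)) u := by
    intro t ht u
    by_cases hu : u ∈ Metric.closedBall (0 : ℂ) (R + S)
    · rw [indicator_of_mem hu, norm_mul, add_sub_cancel_right, div_eq_mul_inv, norm_mul]
      gcongr
      · exact norm_deriv_le_of_lipschitz hlip
      · exact hM _
    · rw [indicator_of_notMem hu]
      have : k (u + γ t) = 0 := by
        by_contra hne
        refine hu ?_
        have h₁ := hR _ (subset_tsupport _ hne)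
        have h₂ := hS _ (mem_image_of_mem γ (Ioc_subset_Icc_self ht))
        rw [mem_closedBall_zero_iff]
        calc ‖u‖ = ‖(u + γ t) - γ t‖ := by simp
          _ ≤ ‖u + γ t‖ + ‖γ t‖ := norm_sub_le _ _
          _ ≤ R + S := add_le_add h₁ h₂
      simp [this]
  have hslice : ∀ t ∈ Ioc (0 : ℝ) 1,
      Integrable fun u : ℂ => deriv γ t * (k (u + γ t) / (u + γ t - γ t)) := by
    intro t ht
    refine hker.mono' ?_ (Filter.Eventually.of_forall (hbound t ht))
    exact (hmeas.comp (measurable_const.prodMk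
      (measurable_id.add_const (γ t)))).aestronglyMeasurable
  rw [integrable_prod_iff hmeas.aestronglyMeasurable]
  refine ⟨(ae_restrict_iff' measurableSet_Ioc).2 (Filter.Eventually.of_forall fun t ht => ?_), ?_⟩
  · have := (hslice t ht).comp_add_right (-γ t)
    simpa [Function.uncurry] using this
  · refine Integrable.mono' (integrable_const (∫ u : ℂ,
      (Metric.closedBall (0 : ℂ) (R + S)).indicator (fun u => K * (M * ‖u⁻¹‖)) u))
      hmeas.aestronglyMeasurable.norm.integral_prod_right'
      ((ae_restrict_iff' measurableSet_Ioc).2 (Filter.Eventually.of_forall fun t ht => ?_))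
    rw [Real.norm_of_nonneg (integral_nonneg fun _ => norm_nonneg _),
      ← integral_add_right_eq_self _ (γ t)]
    exact integral_mono (hslice t ht).norm hker (hbound t ht)

/-- If the winding number vanishes almost everywhere, then so does the integral along the curve of
every compactly supported `C¹` function. -/
lemma integral_comp_mul_deriv_eq_zero {γ : ℝ → ℂ} {K : NNReal} (hlip : LipschitzWith K γ)
    (hw : ∀ᵐ x, winding γ x = 0) {h : ℂ → ℂ} (hh : ContDiff ℝ 1 h)
    (hc : HasCompactSupport h) :
    ∫ t in (0 : ℝ)..1, h (γ t) * deriv γ t = 0 := by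
  set k : ℂ → ℂ := fun w => fderiv ℝ h w 1 + Complex.I * fderiv ℝ h w Complex.I with hk
  have hf : Continuous (fderiv ℝ h) := hh.continuous_fderiv one_ne_zero
  have hkc : Continuous k := by fun_prop
  have hks : HasCompactSupport k :=
    (hc.fderiv (𝕜 := ℝ)).mono fun w hw' h0 => hw' (by simp [hk, h0])
  have h₁ : ∀ t, h (γ t) * deriv γ t =
      -(2 * Real.pi : ℂ)⁻¹ * ∫ w : ℂ, deriv γ t * (k w / (w - γ t)) := by
    intro t
    rw [integral_const_mul, integral_cauchyRiemann_div_sub_s14 hh hc]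
    field_simp
  simp only [h₁]
  rw [intervalIntegral.integral_const_mul, intervalIntegral.integral_of_le zero_le_one,
    integral_integral_swap (integrable_deriv_mul_div_sub hlip hkc hks)]
  have h₂ : ∀ᵐ w : ℂ, ∫ t in Ioc (0 : ℝ) 1, deriv γ t * (k w / (w - γ t)) = 0 := by
    filter_upwards [hw] with w hw
    have h₃ : ∫ t in (0 : ℝ)..1, deriv γ t / (γ t - w) = 0 := by
      simpa [winding, Real.pi_ne_zero] using hw
    have h₄ : ∀ t, deriv γ t * (k w / (w - γ t)) = -k w * (deriv γ t / (γ t - w)) := by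
      intro t
      rw [← neg_sub (γ t) w, div_neg]
      ring
    simp only [h₄]
    rw [integral_const_mul, ← intervalIntegral.integral_of_le zero_le_one, h₃, mul_zero]
  rw [integral_congr_ae h₂]
  simp

/-- parametric Gauss–Green theorem. For a Lipschitz closed curve with zero
winding number off its image and a C¹ 1-form α = α₁ dx₁ + α₂ dx₂ on ℝ² (≅ ℂ), the line
integral of α along γ equals the integral of the curl weighted by the winding number,
and both vanish. -/
theorem stmt_14 (γ : ℝ → ℂ) (hper : Function.Periodic γ 1)
    (K : NNReal) (hlip : LipschitzWith K γ)
    (hw : ∀ x ∉ Set.range γ, winding γ x = 0)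
    (α₁ α₂ : ℂ → ℝ) (h₁ : ContDiff ℝ 1 α₁) (h₂ : ContDiff ℝ 1 α₂) :
    (∫ t in (0:ℝ)..1, (α₁ (γ t) * (deriv γ t).re + α₂ (γ t) * (deriv γ t).im)) =
      (∫ x : ℂ, (winding γ x).re *
        (fderiv ℝ α₂ x (1 : ℂ) - fderiv ℝ α₁ x Complex.I)) ∧
    (∫ t in (0:ℝ)..1, (α₁ (γ t) * (deriv γ t).re + α₂ (γ t) * (deriv γ t).im)) = 0 := by
  have hw' : ∀ᵐ x, winding γ x = 0 := by
    filter_upwards [measure_eq_zero_iff_ae_notMem.1 (volume_range_eq_zero_of_lipschitz hlip)]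
      with x hx using hw x hx
  have hright : ∫ x : ℂ, (winding γ x).re *
      (fderiv ℝ α₂ x (1 : ℂ) - fderiv ℝ α₁ x Complex.I) = 0 := by
    refine integral_eq_zero_of_ae ?_
    filter_upwards [hw'] with x hx
    simp [hx]
  rw [hright, and_self]
  obtain ⟨S, hS⟩ := (isCompact_Icc.image (s := Icc (0 : ℝ) 1)
    (hlip.continuous)).isBounded.exists_norm_le
  let χ : ContDiffBump (0 : ℂ) := ⟨|S| + 1, |S| + 2, by positivity, by linarith⟩
  let h : ℂ → ℂ := fun z => (χ z : ℂ) * ((α₁ z : ℂ) - (α₂ z : ℂ) * Complex.I)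
  have hh : ContDiff ℝ 1 h :=
    (Complex.ofRealCLM.contDiff.comp χ.contDiff).mul
      ((Complex.ofRealCLM.contDiff.comp h₁).sub
        ((Complex.ofRealCLM.contDiff.comp h₂).mul contDiff_const))
  have hc : HasCompactSupport h := by
    refine χ.hasCompactSupport.mono fun z hz h0 => hz ?_
    simp [h, h0]
  have hint : IntervalIntegrable (fun t => h (γ t) * deriv γ t) volume 0 1 := by
    obtain ⟨M, hM⟩ := hh.continuous.bounded_above_of_compact_support hc
    refine (intervalIntegrable_const (c := M * K)).mono_fun
      ((hh.continuous.comp hlip.continuous).measurable.mul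
        (measurable_deriv γ)).aestronglyMeasurable (Filter.Eventually.of_forall fun t => ?_)
    refine le_trans ?_ (le_abs_self _)
    refine (norm_mul_le _ _).trans ?_
    exact mul_le_mul (hM _) (norm_deriv_le_of_lipschitz hlip) (norm_nonneg _)
      ((norm_nonneg _).trans (hM 0))
  have hre := Complex.reCLM.intervalIntegral_comp_comm hint
  rw [integral_comp_mul_deriv_eq_zero hlip hw' hh hc, map_zero] at hre
  refine Eq.trans ?_ hre
  refine intervalIntegral.integral_congr fun t ht => ?_
  rw [uIcc_of_le zero_le_one] at ht
  have hχ : χ (γ t) = 1 := by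
    refine χ.one_of_mem_closedBall ?_
    rw [mem_closedBall_zero_iff]
    exact (hS _ (mem_image_of_mem γ ht)).trans ((le_abs_self S).trans (by simp [χ]))
  simp [h, hχ]
end
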